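/- Let M ⊆ ℂ^{n+1} (n ≥ 1) be a connected nondegenerate real-analytic real hypersurface. If there is a point p ∈ M that is not spherical (i.e. M is not locally biholomorphic to a real hyperquadric at p), then no point of M is spherical: M is not locally biholomorphic to a real hyperquadric at any of its points. -/

import Mathlib

open Complex

/-- The Wirtinger derivative `∂h/∂ζ^j` at `p` of a function `h : ℂ^N → ℂ`, computed
from the real Fréchet derivative: `∂h/∂ζ^j = ½(∂h/∂x^j − i ∂h/∂y^j)`. -/
noncomputable def wirtD (N : ℕ) (j : Fin N) (h : (Fin N → ℂ) → ℂ) (p : Fin N → ℂ) : ℂ :=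
  (1 / 2) * (fderiv ℝ h p (Pi.single j 1) - Complex.I * fderiv ℝ h p (Pi.single j Complex.I))

/-- The conjugate Wirtinger derivative `∂h/∂ζ̄^j = ½(∂h/∂x^j + i ∂h/∂y^j)`. -/
noncomputable def wirtDbar (N : ℕ) (j : Fin N) (h : (Fin N → ℂ) → ℂ) (p : Fin N → ℂ) : ℂ :=
  (1 / 2) * (fderiv ℝ h p (Pi.single j 1) + Complex.I * fderiv ℝ h p (Pi.single j Complex.I))

/-- The Levi matrix `(∂²r/∂ζ^j∂ζ̄^k)_{j,k}` of a real function `r` at `p`. -/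
noncomputable def leviMatrix (N : ℕ) (r : (Fin N → ℂ) → ℝ) (p : Fin N → ℂ)
    (j k : Fin N) : ℂ :=
  wirtD N j (fun q => wirtDbar N k (fun x => ((r x : ℂ))) q) p

/-- The complex tangent space `{v : Σ_j (∂r/∂ζ^j)(p) v^j = 0}`. -/
def complexTangent (N : ℕ) (r : (Fin N → ℂ) → ℝ) (p : Fin N → ℂ) : Set (Fin N → ℂ) :=
  {v | ∑ j : Fin N, wirtD N j (fun x => ((r x : ℂ))) p * v j = 0}

/-- Nondegeneracy of the Levi form of `r` at `p` restricted to the complex tangent space. -/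
def LeviNondeg (N : ℕ) (r : (Fin N → ℂ) → ℝ) (p : Fin N → ℂ) : Prop :=
  ∀ v ∈ complexTangent N r p,
    (∀ w ∈ complexTangent N r p,
      ∑ j : Fin N, ∑ k : Fin N, leviMatrix N r p j k * v j * (starRingEnd ℂ) (w k) = 0)
    → v = 0

/-- A nondegenerate real-analytic real hypersurface of `ℂ^N`. -/
def IsNondegHypersurface (N : ℕ) (M : Set (Fin N → ℂ)) : Prop :=
  ∀ p ∈ M, ∃ (V : Set (Fin N → ℂ)) (r : (Fin N → ℂ) → ℝ),
    IsOpen V ∧ p ∈ V ∧ AnalyticOnNhd ℝ r V ∧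
    M ∩ V = {x ∈ V | r x = 0} ∧
    (∀ x ∈ V, fderiv ℝ r x ≠ 0) ∧
    (∀ x ∈ M ∩ V, LeviNondeg N r x)

/-- The real hyperquadric `Q_e = {Im w = Σ_{α<e} |z^α|² − Σ_{α≥e} |z^α|²}` in
`ℂ^n × ℂ ≅ ℂ^{n+1}`, where `w` is the last coordinate. -/
def hyperquadric (n e : ℕ) : Set (Fin (n + 1) → ℂ) :=
  {ζ | (ζ (Fin.last n)).im
    = ∑ α : Fin n, (if (α : ℕ) < e then (1 : ℝ) else -1) * Complex.normSq (ζ α.castSucc)}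

/-- `p ∈ M` is a spherical point: some neighborhood of `p` in `M` is mapped into a
real hyperquadric by a biholomorphism. -/
def IsSphericalPt (n : ℕ) (M : Set (Fin (n + 1) → ℂ)) (p : Fin (n + 1) → ℂ) : Prop :=
  ∃ (U : Set (Fin (n + 1) → ℂ)) (φ : (Fin (n + 1) → ℂ) → (Fin (n + 1) → ℂ)) (e : ℕ),
    e ≤ n ∧ IsOpen U ∧ p ∈ U ∧
    AnalyticOnNhd ℂ φ U ∧ Set.InjOn φ U ∧ IsOpen (φ '' U) ∧
    (∃ ψ : (Fin (n + 1) → ℂ) → (Fin (n + 1) → ℂ),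
      AnalyticOnNhd ℂ ψ (φ '' U) ∧ ∀ x ∈ U, ψ (φ x) = x) ∧
    φ '' (U ∩ M) ⊆ hyperquadric n e

section
open Topology Filter Metric
open scoped Nat NNReal ENNReal

namespace Sph

theorem bound_iter {E F : Type*} [NormedAddCommGroup E] [NormedSpace ℂ E] [NormedAddCommGroup F]
    [NormedSpace ℂ F] [CompleteSpace F] (A : E → F) (z0 : E) (hA : AnalyticAt ℂ A z0) :
    ∃ δ > 0, ∃ C : ℝ, 0 ≤ C ∧ ∃ a : ℝ, 0 < a ∧ ∀ z1 ∈ ball z0 δ, AnalyticAt ℂ A z1 ∧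
      ∀ i : ℕ, ‖iteratedFDeriv ℂ i A z1‖ ≤ (i ! : ℝ) * (C * a ^ i) := by
  obtain ⟨p, R, hp⟩ := hA
  obtain ⟨s, hs0, hsR⟩ := ENNReal.lt_iff_exists_nnreal_btwn.1 hp.r_pos
  have hs0' : (0:ℝ≥0) < s := by exact_mod_cast hs0
  have hlt : ((s/2 : ℝ≥0) + (s/2 : ℝ≥0) : ℝ≥0∞) < p.radius := by
    have : ((s/2 : ℝ≥0) + (s/2 : ℝ≥0) : ℝ≥0∞) = s := by
      rw [← ENNReal.coe_add, add_halves]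
    rw [this]; exact hsR.trans_le hp.r_le
  have hsum := p.changeOriginSeries_summable_aux₁ hlt
  set t : ℝ≥0 := s/2 with ht
  have ht0 : 0 < t := by positivity
  set Cn : ℝ≥0 := ∑' x : Σ k l : ℕ, { s : Finset (Fin (k + l)) // s.card = l },
      ‖p (x.1 + x.2.1)‖₊ * t ^ x.2.1 * t ^ x.1 with hC
  have htR : (t : ℝ≥0∞) < R := by
    refine lt_of_le_of_lt ?_ hsR
    exact_mod_cast (half_le_self s.2 : s/2 ≤ s)
  refine ⟨t, by exact_mod_cast ht0, Cn, Cn.2, (t:ℝ)⁻¹, by positivity, ?_⟩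
  intro z1 hz1
  have hy : ‖z1 - z0‖₊ ≤ t := by
    have := (mem_ball_iff_norm.1 hz1).le
    exact_mod_cast this
  have hyR : (‖z1 - z0‖₊ : ℝ≥0∞) < R := lt_of_le_of_lt (by exact_mod_cast hy) htR
  have hco := hp.changeOrigin hyR
  rw [add_sub_cancel] at hco
  refine ⟨hco.analyticAt, fun i => ?_⟩
  have hpi : ‖p.changeOrigin (z1 - z0) i‖₊ * t ^ i ≤ Cn := by
    calc ‖p.changeOrigin (z1 - z0) i‖₊ * t ^ i
        ≤ (∑' s : Σ l : ℕ, { s : Finset (Fin (i + l)) // s.card = l },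
            ‖p (i + s.1)‖₊ * ‖z1 - z0‖₊ ^ s.1) * t ^ i := by
          gcongr
          exact p.nnnorm_changeOrigin_le i (hyR.trans_le hp.r_le)
      _ = (∑' s : Σ l : ℕ, { s : Finset (Fin (i + l)) // s.card = l },
            ‖p (i + s.1)‖₊ * ‖z1 - z0‖₊ ^ s.1 * t ^ i) := by
          rw [NNReal.tsum_mul_right]
      _ ≤ (∑' s : Σ l : ℕ, { s : Finset (Fin (i + l)) // s.card = l },
            ‖p (i + s.1)‖₊ * t ^ s.1 * t ^ i) := by
          have hs2 := (NNReal.summable_sigma.1 hsum).1 i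
          refine Summable.tsum_le_tsum (fun s => by gcongr) ?_ hs2
          exact NNReal.summable_of_le (fun s => by gcongr) hs2
      _ ≤ Cn := by
          have h1 := hsum.tsum_sigma' (fun k => (NNReal.summable_sigma.1 hsum).1 k)
          rw [hC, h1]
          exact Summable.le_tsum (NNReal.summable_sigma.1 hsum).2 i (fun _ _ => zero_le)
  have hpi' : ‖p.changeOrigin (z1 - z0) i‖ ≤ Cn * (t:ℝ)⁻¹ ^ i := by
    have : ‖p.changeOrigin (z1 - z0) i‖ * (t:ℝ) ^ i ≤ Cn := by exact_mod_cast hpi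
    rw [inv_pow, ← div_eq_mul_inv, le_div_iff₀ (by positivity)]
    exact this
  refine ContinuousMultilinearMap.opNorm_le_bound (by positivity) (fun v => ?_)
  rw [hco.iteratedFDeriv_eq_sum_of_completeSpace]
  refine (norm_sum_le _ _).trans ?_
  calc ∑ σ : Equiv.Perm (Fin i), ‖p.changeOrigin (z1 - z0) i fun j => v (σ j)‖
      ≤ ∑ σ : Equiv.Perm (Fin i), (Cn * (t:ℝ)⁻¹ ^ i) * ∏ j, ‖v j‖ := by
        refine Finset.sum_le_sum fun σ _ => ?_
        refine (ContinuousMultilinearMap.le_opNorm _ _).trans ?_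
        rw [Equiv.prod_comp σ (fun j => ‖v j‖)]
        gcongr
    _ = _ := by
        rw [Finset.sum_const, Finset.card_univ, Fintype.card_perm, Fintype.card_fin, nsmul_eq_mul]
        ring

theorem bound_sol {E F : Type*} [NormedAddCommGroup E] [NormedSpace ℂ E] [NormedAddCommGroup F]
    [NormedSpace ℂ F] [CompleteSpace F] (A : E → F →L[ℂ] E →L[ℂ] F) (Y : E → F) (z1 : E)
    (hA : AnalyticAt ℂ A z1) (hY : AnalyticAt ℂ Y z1)
    (hpde : ∀ᶠ z in 𝓝 z1, fderiv ℂ Y z = A z (Y z)) (C a b : ℝ) (hC : 0 ≤ C) (ha : 0 < a)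
    (hab : a ≤ b) (hCb : C ≤ b)
    (hb : ∀ i : ℕ, ‖iteratedFDeriv ℂ i A z1‖ ≤ (i ! : ℝ) * (C * a ^ i)) (m : ℕ) :
    ‖iteratedFDeriv ℂ m Y z1‖ ≤ (m ! : ℝ) * b ^ m * ‖Y z1‖ := by
  obtain ⟨s, hs, hso, hz1⟩ := _root_.eventually_nhds_iff.1 (hA.eventually_analyticAt.and hY.eventually_analyticAt)
  have hAs : ContDiffOn ℂ (⊤ : ℕ∞) A s := fun z hz => (hs z hz).1.contDiffAt.contDiffWithinAt
  have hYs : ContDiffOn ℂ (⊤ : ℕ∞) Y s := fun z hz => (hs z hz).2.contDiffAt.contDiffWithinAt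
  have hb0 : 0 < b := ha.trans_le hab
  induction m using Nat.strong_induction_on with
  | _ m ih =>
    rcases m with _ | m
    · simp
    · rw [← norm_iteratedFDeriv_fderiv]
      have h1 : iteratedFDeriv ℂ m (fderiv ℂ Y) z1 = iteratedFDeriv ℂ m (fun z => A z (Y z)) z1 :=
        (Filter.EventuallyEq.iteratedFDeriv ℂ (hpde : fderiv ℂ Y =ᶠ[𝓝 z1] fun z => A z (Y z)) m).eq_of_nhds
      rw [h1]
      have h2 := norm_iteratedFDerivWithin_clm_apply
        hAs hYs hso.uniqueDiffOn hz1 (n := m) (by exact_mod_cast le_top)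
      simp only [iteratedFDerivWithin_of_isOpen _ hso hz1] at h2
      refine h2.trans ?_
      have h3 : ∀ i ∈ Finset.range (m+1), (m.choose i : ℝ) * ‖iteratedFDeriv ℂ i A z1‖ *
          ‖iteratedFDeriv ℂ (m - i) Y z1‖ ≤ (m ! : ℝ) * b ^ (m+1) * ‖Y z1‖ := by
        intro i hi
        have him : i ≤ m := by simpa [Nat.lt_succ_iff] using hi
        calc (m.choose i : ℝ) * ‖iteratedFDeriv ℂ i A z1‖ * ‖iteratedFDeriv ℂ (m - i) Y z1‖
            ≤ (m.choose i : ℝ) * ((i ! : ℝ) * (b * b ^ i)) * (((m - i)! : ℝ) * b ^ (m-i) * ‖Y z1‖) := by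
              gcongr
              · refine (hb i).trans ?_
                gcongr
              · exact ih (m-i) (by omega)
          _ = ((m.choose i * i ! * (m-i)! : ℕ) : ℝ) * (b * (b ^ i * b ^ (m-i))) * ‖Y z1‖ := by
              push_cast; ring
          _ = (m ! : ℝ) * b ^ (m+1) * ‖Y z1‖ := by
              rw [Nat.choose_mul_factorial_mul_factorial him, ← pow_add, Nat.add_sub_cancel' him]; ring
      refine (Finset.sum_le_sum h3).trans (le_of_eq ?_)
      rw [Finset.sum_const, Finset.card_range, nsmul_eq_mul, Nat.factorial_succ]
      push_cast; ring

theorem ext_pde {E F : Type*} [NormedAddCommGroup E] [NormedSpace ℂ E] [NormedAddCommGroup F]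
    [NormedSpace ℂ F] [CompleteSpace F] (A : E → F →L[ℂ] E →L[ℂ] F) (z0 : E)
    (hA : AnalyticAt ℂ A z0) :
    ∃ δ > 0, ∀ z1 ∈ ball z0 δ, ∀ Y : E → F, AnalyticAt ℂ Y z1 →
      (∀ᶠ z in 𝓝 z1, fderiv ℂ Y z = A z (Y z)) →
      ∃ Y' : E → F, AnalyticOnNhd ℂ Y' (ball z0 δ) ∧ Y' =ᶠ[𝓝 z1] Y := by
  obtain ⟨δ0, hδ0, C, hC, a, ha, hb⟩ := bound_iter A z0 hA
  set b := max a C with hbdef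
  have hb0 : 0 < b := ha.trans_le (le_max_left _ _)
  set t : ℝ≥0 := ⟨b⁻¹, by positivity⟩ with ht
  refine ⟨min δ0 (b⁻¹/2), lt_min hδ0 (by positivity), fun z1 hz1 Y hY hpde => ?_⟩
  have hz1' : z1 ∈ ball z0 δ0 := ball_subset_ball (min_le_left _ _) hz1
  obtain ⟨hA1, hAb⟩ := hb z1 hz1'
  have hbd := bound_sol A Y z1 hA1 hY hpde C a b hC ha (le_max_left _ _) (le_max_right _ _) hAb
  set p' : FormalMultilinearSeries ℂ E F := fun m => ((m ! : ℂ)⁻¹) • iteratedFDeriv ℂ m Y z1 with hp'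
  have hrad : (t : ℝ≥0∞) ≤ p'.radius := by
    refine p'.le_radius_of_bound (‖Y z1‖) fun m => ?_
    have h1 : ‖p' m‖ ≤ b ^ m * ‖Y z1‖ := by
      rw [hp', norm_smul, norm_inv, Complex.norm_natCast]
      rw [inv_mul_le_iff₀ (by positivity), ← mul_assoc]
      exact hbd m
    calc ‖p' m‖ * (t:ℝ)^m ≤ (b ^ m * ‖Y z1‖) * (t:ℝ)^m := by gcongr
      _ = ‖Y z1‖ := by
        have : (t:ℝ) = b⁻¹ := rfl
        rw [this, inv_pow]; field_simp
  have ht0 : 0 < t := by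
    have : (0:ℝ) < (t:ℝ) := by change 0 < b⁻¹; positivity
    exact_mod_cast this
  have hsum := p'.hasFPowerSeriesOnBall (lt_of_lt_of_le (by exact_mod_cast ht0) hrad)
  have hsum2 : HasFPowerSeriesOnBall (fun z => p'.sum (z - z1)) p' z1 p'.radius := by
    simpa using hsum.comp_sub z1
  refine ⟨fun z => p'.sum (z - z1), ?_, ?_⟩
  · intro z hz
    refine hsum2.analyticAt_of_mem ?_
    have hd : dist z z1 < b⁻¹ := by
      have h1 : dist z z0 < b⁻¹/2 := (mem_ball.1 hz).trans_le (min_le_right _ _)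
      have h2 : dist z1 z0 < b⁻¹/2 := (mem_ball.1 hz1).trans_le (min_le_right _ _)
      have := dist_triangle_right z z1 z0
      linarith
    refine eball_subset_eball hrad ?_
    rw [mem_eball, edist_dist]
    rw [show (t : ℝ≥0∞) = ENNReal.ofReal b⁻¹ by
      rw [ht, ENNReal.ofReal, Real.toNNReal_of_nonneg (inv_nonneg.2 hb0.le)]; rfl]
    exact (ENNReal.ofReal_lt_ofReal_iff (by positivity)).2 hd
  · obtain ⟨p, R, hp⟩ := hY
    have h1 : ∀ᶠ z in 𝓝 z1, z ∈ eball z1 R := eball_mem_nhds z1 hp.r_pos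
    have h2 : ∀ᶠ z in 𝓝 z1, z ∈ eball z1 p'.radius := eball_mem_nhds z1 hsum2.r_pos
    filter_upwards [h1, h2] with z hz hz2
    have e1 := hp.hasSum_sub hz
    have e2 := hsum2.hasSum_sub hz2
    refine e2.unique ?_
    convert e1 using 2 with m
    have := hp.factorial_smul (z - z1) m
    rw [hp']
    simp only [smul_apply]
    rw [← this, ← Nat.cast_smul_eq_nsmul ℂ, smul_smul, inv_mul_cancel₀ (by exact_mod_cast Nat.factorial_ne_zero m), one_smul]

end Sph
end

section
open Topology Filter Metric
open scoped NNReal ENNReal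

namespace Sph

theorem complexify0 {ι : Type} [Fintype ι] [DecidableEq ι] (g : (ι → ℝ) → ℝ) (hg : AnalyticAt ℝ g 0) :
    ∃ G : (ι → ℂ) → ℂ, AnalyticAt ℂ G 0 ∧ ∀ᶠ x : ι → ℝ in 𝓝 0, G (fun i => (x i : ℂ)) = (g x : ℂ) := by
  obtain ⟨P, R, hP⟩ := hg
  let PC : FormalMultilinearSeries ℂ (ι → ℂ) ℂ := fun k =>
    ∑ i : Fin k → ι, ((P k (fun j => Pi.single (i j) (1:ℝ)) : ℝ) : ℂ) •
      (ContinuousMultilinearMap.mkPiAlgebra ℂ (Fin k) ℂ).compContinuousLinearMap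
        (fun j => ContinuousLinearMap.proj (R := ℂ) (φ := fun _ : ι => ℂ) (i j))
  have hPCapp : ∀ k (v : Fin k → ι → ℂ), PC k v = ∑ i : Fin k → ι,
      ((P k (fun j => Pi.single (i j) (1:ℝ)) : ℝ) : ℂ) * ∏ j, v j (i j) := by
    intro k v
    simp [PC]
  have hnorm : ∀ k, ‖PC k‖ ≤ (Fintype.card ι : ℝ) ^ k * ‖P k‖ := by
    intro k
    refine ContinuousMultilinearMap.opNorm_le_bound (by positivity) fun v => ?_
    rw [hPCapp]
    refine (norm_sum_le _ _).trans ?_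
    calc ∑ i : Fin k → ι, ‖((P k (fun j => Pi.single (i j) (1:ℝ)) : ℝ) : ℂ) * ∏ j, v j (i j)‖
        ≤ ∑ i : Fin k → ι, ‖P k‖ * ∏ j, ‖v j‖ := by
          refine Finset.sum_le_sum fun i _ => ?_
          rw [norm_mul, norm_prod, Complex.norm_real]
          gcongr with j
          · refine (ContinuousMultilinearMap.le_opNorm _ _).trans (le_of_eq ?_)
            rw [Finset.prod_eq_one, mul_one]
            intro j _
            exact (Pi.norm_single (G := fun _ : ι => ℝ) (1:ℝ)).trans norm_one
          · exact norm_le_pi_norm _ _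
      _ = _ := by
          rw [Finset.sum_const, Finset.card_univ, Fintype.card_fun, Fintype.card_fin, nsmul_eq_mul]
          push_cast; ring
  obtain ⟨s, hs0, hsR⟩ := ENNReal.lt_iff_exists_nnreal_btwn.1 hP.r_pos
  have hs0' : (0:ℝ≥0) < s := by exact_mod_cast hs0
  obtain ⟨C, hC0, hC⟩ := P.norm_mul_pow_le_of_lt_radius (hsR.trans_le hP.r_le)
  set t : ℝ≥0 := s / (Fintype.card ι + 1) with ht
  have ht0 : 0 < t := by positivity
  have hrad : (t : ℝ≥0∞) ≤ PC.radius := by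
    refine PC.le_radius_of_bound C fun k => ?_
    calc ‖PC k‖ * (t:ℝ)^k ≤ ((Fintype.card ι : ℝ) ^ k * ‖P k‖) * (t:ℝ)^k := by
          gcongr; exact hnorm k
      _ = ‖P k‖ * ((Fintype.card ι : ℝ) * t) ^ k := by rw [mul_pow]; ring
      _ ≤ ‖P k‖ * (s:ℝ) ^ k := by
          gcongr
          rw [ht]; push_cast
          rw [mul_div_assoc', div_le_iff₀ (by positivity)]
          nlinarith [s.2, (s.coe_nonneg)]
      _ ≤ C := hC k
  have hsum := PC.hasFPowerSeriesOnBall (lt_of_lt_of_le (by exact_mod_cast ht0) hrad)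
  refine ⟨PC.sum, hsum.analyticAt, ?_⟩
  have hcont : Continuous (fun x : ι → ℝ => (fun i => (x i : ℂ))) := by fun_prop
  have h2 : ∀ᶠ x : ι → ℝ in 𝓝 0, (fun i => (x i : ℂ)) ∈ eball (0 : ι → ℂ) PC.radius := by
    have := hcont.tendsto 0
    refine this.eventually ?_
    have : (fun i => ((0 : ι → ℝ) i : ℂ)) = 0 := by ext; simp
    rw [this]
    exact eball_mem_nhds _ hsum.r_pos
  filter_upwards [eball_mem_nhds (0 : ι → ℝ) hP.r_pos, h2] with x hx hx2
  have e1 := hP.hasSum_sub hx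
  have e2 := hsum.hasSum_sub hx2
  refine e2.unique ?_
  have e3 := Complex.hasSum_ofReal.2 e1
  refine e3.congr_fun fun k => ?_
  rw [hPCapp, sub_zero, sub_zero]
  conv_rhs => rw [show (fun _ : Fin k => x) = fun _ => ∑ i, x i • (Pi.single i (1:ℝ) : ι → ℝ) by
    funext _; exact (pi_eq_sum_univ' x)]
  rw [ContinuousMultilinearMap.map_sum]
  push_cast
  refine Finset.sum_congr rfl fun i _ => ?_
  rw [ContinuousMultilinearMap.map_smul_univ]
  simp [mul_comm]

theorem complexify (N : ℕ) (r : (Fin N → ℂ) → ℝ) (p : Fin N → ℂ) (hr : AnalyticAt ℝ r p) :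
    ∃ R : (Fin N → ℂ) × (Fin N → ℂ) → ℂ, AnalyticAt ℂ R (p, star p) ∧
      ∀ᶠ z in 𝓝 p, R (z, star z) = (r z : ℂ) := by
  let L : (Fin N ⊕ Fin N → ℝ) →L[ℝ] (Fin N → ℂ) :=
    ContinuousLinearMap.pi fun j =>
      (Complex.ofRealCLM.comp (ContinuousLinearMap.proj (Sum.inl j)))
       + (Complex.I • Complex.ofRealCLM.comp (ContinuousLinearMap.proj (Sum.inr j)))
  have hL : ∀ x j, L x j = x (Sum.inl j) + Complex.I * x (Sum.inr j) := by
    intro x j; simp [L]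
  have hg : AnalyticAt ℝ (fun x => r (p + L x)) 0 := by
    have h1 : AnalyticAt ℝ (fun x => p + L x) 0 := analyticAt_const.add (L.analyticAt 0)
    refine AnalyticAt.fun_comp ?_ h1
    simpa using hr
  obtain ⟨G, hG, hGr⟩ := complexify0 _ hg
  let T : (Fin N → ℂ) × (Fin N → ℂ) → (Fin N ⊕ Fin N → ℂ) := fun x =>
    Sum.elim (fun j => ((x.1 j - p j) + (x.2 j - star (p j))) / 2)
      (fun j => ((x.1 j - p j) - (x.2 j - star (p j))) / (2 * Complex.I))
  have hT : ∀ x, AnalyticAt ℂ T x := by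
    intro x
    rw [analyticAt_pi_iff]
    have ha : ∀ j, AnalyticAt ℂ (fun x : (Fin N → ℂ) × (Fin N → ℂ) => x.1 j) x := fun j =>
      ((ContinuousLinearMap.proj (R := ℂ) (φ := fun _ : Fin N => ℂ) j).comp (ContinuousLinearMap.fst ℂ _ _)).analyticAt x
    have hb : ∀ j, AnalyticAt ℂ (fun x : (Fin N → ℂ) × (Fin N → ℂ) => x.2 j) x := fun j =>
      ((ContinuousLinearMap.proj (R := ℂ) (φ := fun _ : Fin N => ℂ) j).comp (ContinuousLinearMap.snd ℂ _ _)).analyticAt x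
    rintro (j | j)
    · exact (((ha j).sub analyticAt_const).add ((hb j).sub analyticAt_const)).mul analyticAt_const
    · exact (((ha j).sub analyticAt_const).sub ((hb j).sub analyticAt_const)).mul analyticAt_const
  have hT0 : T (p, star p) = 0 := by
    ext (j | j) <;> simp [T]
  refine ⟨fun x => G (T x), ?_, ?_⟩
  · refine AnalyticAt.fun_comp ?_ (hT _)
    rw [hT0]; exact hG
  · let S : (Fin N → ℂ) → (Fin N ⊕ Fin N → ℝ) := fun z =>
      Sum.elim (fun j => (z j - p j).re) (fun j => (z j - p j).im)
    have hS : Continuous S := by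
      refine continuous_pi ?_
      rintro (j | j) <;> simp only [S, Sum.elim_inl, Sum.elim_inr] <;> fun_prop
    have hS0 : S p = 0 := by ext (j | j) <;> simp [S]
    have h1 := (hS.tendsto p).eventually (hS0 ▸ hGr)
    filter_upwards [h1] with z hz
    have e1 : p + L (S z) = z := by
      ext j
      simp only [Pi.add_apply, hL, S, Sum.elim_inl, Sum.elim_inr]
      rw [mul_comm Complex.I, Complex.re_add_im]; ring
    have e2 : T (z, star z) = fun i => (S z i : ℂ) := by
      ext (j | j)
      · simp only [T, S, Sum.elim_inl, Pi.star_apply]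
        rw [← star_sub, Complex.star_def, Complex.add_conj]; simp
      · simp only [T, S, Sum.elim_inr, Pi.star_apply]
        rw [← star_sub, Complex.star_def, Complex.sub_conj]
        push_cast
        field_simp
    rw [e1] at hz
    rw [e2, hz]

end Sph
end

section
open Topology Filter Metric

namespace Sph

/-- insert `s` in position `j0`. -/
noncomputable def ins {n : ℕ} (j0 : Fin (n+1)) : (ℂ × (Fin n → ℂ)) →L[ℂ] (Fin (n+1) → ℂ) :=
  ContinuousLinearMap.pi fun i => j0.insertNth (α := fun _ => (ℂ × (Fin n → ℂ)) →L[ℂ] ℂ)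
    (ContinuousLinearMap.fst ℂ ℂ (Fin n → ℂ))
    (fun a => (ContinuousLinearMap.proj a).comp (ContinuousLinearMap.snd ℂ ℂ (Fin n → ℂ))) i

/-- remove the coordinate `j0`. -/
noncomputable def rem {n : ℕ} (j0 : Fin (n+1)) : (Fin (n+1) → ℂ) →L[ℂ] (Fin n → ℂ) :=
  ContinuousLinearMap.pi fun a => ContinuousLinearMap.proj (j0.succAbove a)

@[simp] theorem ins_same {n : ℕ} (j0 : Fin (n+1)) (x : ℂ × (Fin n → ℂ)) : ins j0 x j0 = x.1 := by
  simp [ins]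

@[simp] theorem ins_succAbove {n : ℕ} (j0 : Fin (n+1)) (x : ℂ × (Fin n → ℂ)) (a : Fin n) :
    ins j0 x (j0.succAbove a) = x.2 a := by
  simp [ins]

@[simp] theorem rem_apply {n : ℕ} (j0 : Fin (n+1)) (x : Fin (n+1) → ℂ) (a : Fin n) :
    rem j0 x a = x (j0.succAbove a) := rfl

theorem ins_rem {n : ℕ} (j0 : Fin (n+1)) (x : Fin (n+1) → ℂ) : ins j0 (x j0, rem j0 x) = x := by
  ext i
  refine Fin.succAboveCases j0 ?_ ?_ i <;> simp

theorem rem_ins {n : ℕ} (j0 : Fin (n+1)) (x : ℂ × (Fin n → ℂ)) : rem j0 (ins j0 x) = x.2 := by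
  ext i; simp

theorem ins_s0 {n : ℕ} (j0 : Fin (n+1)) (s : ℂ) : ins j0 (s, 0) = s • Pi.single j0 1 := by
  ext i
  refine Fin.succAboveCases j0 ?_ ?_ i <;> simp

/-- conjugation as a real-linear continuous map -/
noncomputable def conjL (N : ℕ) : (Fin N → ℂ) →L[ℝ] (Fin N → ℂ) :=
  ContinuousLinearMap.pi fun i => (Complex.conjCLE : ℂ →L[ℝ] ℂ).comp (ContinuousLinearMap.proj i)

@[simp] theorem conjL_apply (N : ℕ) (z : Fin N → ℂ) : conjL N z = star z := by
  ext i; simp [conjL]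

/-- `z ↦ (z, z̄')`. -/
noncomputable def sharp {n : ℕ} (j0 : Fin (n+1)) : (Fin (n+1) → ℂ) →L[ℝ] (Fin (n+1) → ℂ) × (Fin n → ℂ) :=
  (ContinuousLinearMap.id ℝ _).prod (((rem j0).restrictScalars ℝ).comp (conjL (n+1)))

theorem sharp_apply {n : ℕ} (j0 : Fin (n+1)) (z : Fin (n+1) → ℂ) :
    sharp j0 z = (z, rem j0 (star z)) := by
  simp [sharp]

theorem ker_deriv {E F : Type*} [NormedAddCommGroup E] [NormedSpace ℝ E] [CompleteSpace E]
    [NormedAddCommGroup F] [NormedSpace ℝ F] (r : E → ℝ) (z : E) (r' : E →L[ℝ] ℝ)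
    (hr : HasStrictFDerivAt r r' z) (hr' : r' ≠ 0) (h : E → F) (h' : E →L[ℝ] F)
    (hh : HasFDerivAt h h' z) (h0 : ∀ᶠ y in 𝓝 z, r y = r z → h y = 0) (v : E) (hv : r' v = 0) :
    h' v = 0 := by
  have hsurj : r'.range = ⊤ := by
    obtain ⟨w, hw⟩ : ∃ w, r' w ≠ 0 := by
      by_contra hcon; push Not at hcon; exact hr' (by ext w; simpa using hcon w)
    rw [LinearMap.range_eq_top]
    intro t
    exact ⟨(t / r' w) • w, by simp [hw]⟩
  let γ := hr.implicitFunction r r' hsurj (r z)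
  have hγ : HasStrictFDerivAt γ r'.ker.subtypeL 0 := hr.to_implicitFunction hsurj
  have hγ0 : γ 0 = z := by
    exact hr.implicitFunction_apply_image hsurj
  have h1 : ∀ᶠ k in 𝓝 (0 : r'.ker), r (γ k) = r z := by
    have := (hr.map_implicitFunction_eq hsurj)
    exact ((Continuous.prodMk_right (r z)).tendsto (0 : r'.ker)).eventually this
  have h2 : ∀ᶠ k in 𝓝 (0 : r'.ker), h (γ k) = 0 := by
    have := hγ.hasFDerivAt.continuousAt.eventually (hγ0.symm ▸ h0)
    filter_upwards [h1, this] with k hk1 hk2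
    exact hk2 (by rw [hγ0]; exact hk1)
  have h3 : HasFDerivAt (fun k => h (γ k)) (h'.comp r'.ker.subtypeL) 0 :=
    HasFDerivAt.comp _ (hγ0.symm ▸ hh) hγ.hasFDerivAt
  have h4 : HasFDerivAt (fun k => h (γ k)) (0 : r'.ker →L[ℝ] F) 0 :=
    (hasFDerivAt_const (0:F) (0 : r'.ker)).congr_of_eventuallyEq h2
  have h5 := h3.unique h4
  simpa using congrArg (fun L => L ⟨v, hv⟩) h5

theorem tot_real_step {n : ℕ} {F : Type} [NormedAddCommGroup F] [NormedSpace ℂ F]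
    (j0 : Fin (n+1)) (r : (Fin (n+1) → ℂ) → ℝ) (z : Fin (n+1) → ℂ) (hr : AnalyticAt ℝ r z)
    (hd : fderiv ℝ r z (Pi.single j0 1) ≠ 0 ∨ fderiv ℝ r z (Pi.single j0 Complex.I) ≠ 0)
    (G : (Fin (n+1) → ℂ) × (Fin n → ℂ) → F) (hG : DifferentiableAt ℂ G (sharp j0 z))
    (h0 : ∀ᶠ y in 𝓝 z, r y = r z → G (sharp j0 y) = 0) : fderiv ℂ G (sharp j0 z) = 0 := by
  have hstr : HasStrictFDerivAt r (fderiv ℝ r z) z := hr.hasStrictFDerivAt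
  set r' := fderiv ℝ r z with hr'
  have hne : r' ≠ 0 := by
    rintro h; rw [h] at hd; simp at hd
  set D := fderiv ℂ G (sharp j0 z) with hD
  have hcomp : HasFDerivAt (fun y => G (sharp j0 y)) ((D.restrictScalars ℝ).comp (sharp j0)) z :=
    HasFDerivAt.comp z (hG.hasFDerivAt.restrictScalars ℝ) (sharp j0).hasFDerivAt
  have hker := ker_deriv r z r' hstr hne _ _ hcomp h0
  obtain ⟨v0, hv0⟩ : ∃ w, r' w ≠ 0 := by
    rcases hd with h | h
    · exact ⟨_, h⟩
    · exact ⟨_, h⟩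
  obtain ⟨c, hc⟩ : ∃ c : F, ∀ v, D (v, rem j0 (star v)) = (r' v : ℂ) • c := by
    refine ⟨((r' v0 : ℂ))⁻¹ • D (sharp j0 v0), fun v => ?_⟩
    have h1 := hker (v - (r' v / r' v0) • v0) (by simp [hv0])
    rw [map_sub, map_smul, sub_eq_zero] at h1
    simp only [ContinuousLinearMap.comp_apply, ContinuousLinearMap.coe_restrictScalars', sharp_apply] at h1
    rw [h1, sharp_apply, smul_smul, ← Complex.coe_smul]
    push_cast; rw [div_eq_mul_inv]
  have split : ∀ (v : Fin (n+1) → ℂ) (u : Fin n → ℂ), D (v, u) = D (v, 0) + D (0, u) := by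
    intro v u
    rw [← map_add]; simp
  have hI : ∀ v : Fin (n+1) → ℂ, D (v, 0) - D (0, rem j0 (star v)) = -Complex.I • (r' (Complex.I • v) : ℂ) • c := by
    intro v
    have h1 := hc (Complex.I • v)
    have h2 : rem j0 (star (Complex.I • v)) = (-Complex.I) • rem j0 (star v) := by
      rw [star_smul, map_smul]; simp
    rw [h2, split] at h1
    have h3 : ((Complex.I • v, 0) : (Fin (n+1) → ℂ) × (Fin n → ℂ)) = Complex.I • (v, 0) := by simp
    have h4 : ((0, (-Complex.I) • rem j0 (star v)) : (Fin (n+1) → ℂ) × (Fin n → ℂ)) = (-Complex.I) • (0, rem j0 (star v)) := by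
      simp
    rw [h3, h4, map_smul, map_smul] at h1
    rw [← h1, smul_add, smul_smul, smul_smul]
    simp [sub_eq_add_neg]
  have hb : ∀ v : Fin (n+1) → ℂ, (2:ℂ) • D (0, rem j0 (star v)) = ((r' v : ℂ) + Complex.I * (r' (Complex.I • v) : ℂ)) • c := by
    intro v
    have h1 := hc v
    rw [split] at h1
    have h2 := hI v
    rw [add_smul, ← h1, mul_smul, two_smul]
    have h5 : Complex.I • (r' (Complex.I • v) : ℂ) • c = -(D (v, 0) - D (0, rem j0 (star v))) := by
      rw [h2]; simp
    rw [h5]; abel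
  have hc0 : c = 0 := by
    have h1 := hb (Pi.single j0 1)
    have h2 : rem j0 (star (Pi.single j0 (1:ℂ))) = 0 := by
      ext a; simp
    have h3 : Complex.I • (Pi.single j0 (1:ℂ) : Fin (n+1) → ℂ) = Pi.single j0 Complex.I := by
      rw [← Pi.single_smul]; simp
    rw [h2, h3] at h1
    have h4 : D ((0 : Fin (n+1) → ℂ), (0 : Fin n → ℂ)) = 0 := map_zero D
    rw [h4, smul_zero] at h1
    rcases smul_eq_zero.1 h1.symm with h | h
    · exfalso
      have hre := congrArg Complex.re h
      have him := congrArg Complex.im h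
      simp at hre him
      rcases hd with h | h
      · exact h hre
      · exact h him
    · exact h
  have hb0 : ∀ u : Fin n → ℂ, D (0, u) = 0 := by
    intro u
    have h1 := hb (star (ins j0 (0, u)))
    rw [star_star, rem_ins, hc0, smul_zero] at h1
    simpa using h1
  refine ContinuousLinearMap.ext fun x => ?_
  obtain ⟨v, u⟩ := x
  have h1 := hc v
  rw [split, hb0, hc0, smul_zero, add_zero] at h1
  rw [split, h1, hb0]; simp

theorem tot_real_iter {n : ℕ} (j0 : Fin (n+1)) (r : (Fin (n+1) → ℂ) → ℝ) (q : Fin (n+1) → ℂ)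
    (hr : AnalyticAt ℝ r q) (hq : r q = 0)
    (hd : fderiv ℝ r q (Pi.single j0 1) ≠ 0 ∨ fderiv ℝ r q (Pi.single j0 Complex.I) ≠ 0) (k : ℕ) :
    ∀ (F : Type) [NormedAddCommGroup F] [NormedSpace ℂ F] [CompleteSpace F] 
    (G : (Fin (n+1) → ℂ) × (Fin n → ℂ) → F), AnalyticAt ℂ G (sharp j0 q) →
    (∀ᶠ y in 𝓝 q, r y = 0 → G (sharp j0 y) = 0) → iteratedFDeriv ℂ k G (sharp j0 q) = 0 := by
  induction k with
  | zero =>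
    intro F _ _ _ G hG h0
    have := h0.self_of_nhds hq
    rw [← norm_eq_zero, norm_iteratedFDeriv_zero, this, norm_zero]
  | succ k ih =>
    intro F _ _ _ G hG h0
    rw [← norm_eq_zero, ← norm_iteratedFDeriv_fderiv, norm_eq_zero]
    refine ih _ (fderiv ℂ G) hG.fderiv ?_
    have hd' : ∀ᶠ z in 𝓝 q, fderiv ℝ r z (Pi.single j0 1) ≠ 0 ∨ fderiv ℝ r z (Pi.single j0 Complex.I) ≠ 0 := by
      have hcont : ContinuousAt (fderiv ℝ r) q := hr.fderiv.continuousAt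
      rcases hd with h | h
      · have : ContinuousAt (fun z => fderiv ℝ r z (Pi.single j0 1)) q := hcont.clm_apply continuousAt_const
        exact (this.eventually_ne h).mono fun z hz => Or.inl hz
      · have : ContinuousAt (fun z => fderiv ℝ r z (Pi.single j0 Complex.I)) q := hcont.clm_apply continuousAt_const
        exact (this.eventually_ne h).mono fun z hz => Or.inr hz
    have hG' : ∀ᶠ z in 𝓝 q, AnalyticAt ℂ G (sharp j0 z) :=
      (sharp j0).continuous.continuousAt.eventually hG.eventually_analyticAt
    filter_upwards [hd', hG', hr.eventually_analyticAt, h0.eventually_nhds] with z h1 h2 h3 h4 hz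
    refine tot_real_step j0 r z h3 h1 G h2.differentiableAt ?_
    rw [hz]; exact h4

theorem zero_of_iter {E F : Type*} [NormedAddCommGroup E] [NormedSpace ℂ E] [NormedAddCommGroup F]
    [NormedSpace ℂ F] [CompleteSpace F] (G : E → F) (x : E) (hG : AnalyticAt ℂ G x)
    (h : ∀ k, iteratedFDeriv ℂ k G x = 0) : ∀ᶠ y in 𝓝 x, G y = 0 := by
  obtain ⟨p, R, hp⟩ := hG
  filter_upwards [eball_mem_nhds x hp.r_pos] with y hy
  have e1 := hp.hasSum_sub hy
  refine e1.unique ?_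
  convert hasSum_zero with k
  have := hp.factorial_smul (y - x) k
  rw [h, ← Nat.cast_smul_eq_nsmul ℂ] at this
  exact (smul_eq_zero.1 this).resolve_left (by exact_mod_cast Nat.factorial_ne_zero k)

theorem tot_real {n : ℕ} (j0 : Fin (n+1)) (r : (Fin (n+1) → ℂ) → ℝ) (q : Fin (n+1) → ℂ)
    (hr : AnalyticAt ℝ r q) (hq : r q = 0)
    (hd : fderiv ℝ r q (Pi.single j0 1) ≠ 0 ∨ fderiv ℝ r q (Pi.single j0 Complex.I) ≠ 0)
    (F : Type) [NormedAddCommGroup F] [NormedSpace ℂ F] [CompleteSpace F] 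
    (G : (Fin (n+1) → ℂ) × (Fin n → ℂ) → F) (hG : AnalyticAt ℂ G (sharp j0 q))
    (h0 : ∀ᶠ y in 𝓝 q, r y = 0 → G (sharp j0 y) = 0) : ∀ᶠ x in 𝓝 (sharp j0 q), G x = 0 :=
  zero_of_iter G _ hG fun k => tot_real_iter j0 r q hr hq hd k F G hG h0

end Sph
end

section
open Topology Filter Metric

namespace Sph

/-- `z ↦ (z, z̄)` -/
noncomputable def dbl (N : ℕ) : (Fin N → ℂ) →L[ℝ] (Fin N → ℂ) × (Fin N → ℂ) :=
  (ContinuousLinearMap.id ℝ _).prod (conjL N)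

theorem dbl_apply (N : ℕ) (z : Fin N → ℂ) : dbl N z = (z, star z) := by simp [dbl]

theorem split_pair {E W F : Type*} [NormedAddCommGroup E] [NormedSpace ℂ E] [NormedAddCommGroup W]
    [NormedSpace ℂ W] [NormedAddCommGroup F] [NormedSpace ℂ F] (D : E × W →L[ℂ] F) (v : E) (u : W) :
    D (v, u) = D (v, 0) + D (0, u) := by
  rw [← map_add]; simp

theorem smul_pair1 {E W F : Type*} [NormedAddCommGroup E] [NormedSpace ℂ E] [NormedAddCommGroup W]
    [NormedSpace ℂ W] [NormedAddCommGroup F] [NormedSpace ℂ F] (D : E × W →L[ℂ] F) (c : ℂ) (v : E) :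
    D (c • v, 0) = c • D (v, 0) := by
  rw [← map_smul]; simp

theorem smul_pair2 {E W F : Type*} [NormedAddCommGroup E] [NormedSpace ℂ E] [NormedAddCommGroup W]
    [NormedSpace ℂ W] [NormedAddCommGroup F] [NormedSpace ℂ F] (D : E × W →L[ℂ] F) (c : ℂ) (v : W) :
    D (0, c • v) = c • D (0, v) := by
  rw [← map_smul]; simp

theorem fderiv_dbl {N : ℕ} (R : (Fin N → ℂ) × (Fin N → ℂ) → ℂ) (z : Fin N → ℂ)
    (hR : DifferentiableAt ℂ R (z, star z)) (v : Fin N → ℂ) :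
    fderiv ℝ (fun z => R (z, star z)) z v = fderiv ℂ R (z, star z) (v, star v) := by
  have h : HasFDerivAt (fun z => R (dbl N z)) (((fderiv ℂ R (dbl N z)).restrictScalars ℝ).comp (dbl N)) z :=
    HasFDerivAt.comp z ((by rw [dbl_apply]; exact hR : DifferentiableAt ℂ R (dbl N z)).hasFDerivAt.restrictScalars ℝ) (dbl N).hasFDerivAt
  simp only [dbl_apply] at h
  rw [h.fderiv]
  simp [dbl_apply]

theorem single_I {N : ℕ} (j : Fin N) : (Pi.single j Complex.I : Fin N → ℂ) = Complex.I • Pi.single j 1 := by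
  rw [← Pi.single_smul]; simp

theorem star_single1 {N : ℕ} (j : Fin N) : star (Pi.single j 1 : Fin N → ℂ) = Pi.single j 1 := by
  rw [← Pi.single_star]; simp

theorem star_singleI {N : ℕ} (j : Fin N) : star (Pi.single j Complex.I : Fin N → ℂ) = (-Complex.I) • Pi.single j 1 := by
  rw [single_I, star_smul, star_single1]; simp

theorem wirtD_dbl {N : ℕ} (R : (Fin N → ℂ) × (Fin N → ℂ) → ℂ) (z : Fin N → ℂ)
    (hR : DifferentiableAt ℂ R (z, star z)) (j : Fin N) :
    wirtD N j (fun z => R (z, star z)) z = fderiv ℂ R (z, star z) (Pi.single j 1, 0) := by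
  rw [wirtD, fderiv_dbl R z hR, fderiv_dbl R z hR, star_single1, star_singleI, single_I, split_pair,
    split_pair _ (Complex.I • _), smul_pair1, smul_pair2]
  simp only [smul_eq_mul]
  linear_combination (-(1/2) * (fderiv ℂ R (z, star z) (Pi.single j 1, 0)) + (1/2) * fderiv ℂ R (z, star z) (0, Pi.single j 1)) * Complex.I_sq

theorem wirtDbar_dbl {N : ℕ} (R : (Fin N → ℂ) × (Fin N → ℂ) → ℂ) (z : Fin N → ℂ)
    (hR : DifferentiableAt ℂ R (z, star z)) (j : Fin N) :
    wirtDbar N j (fun z => R (z, star z)) z = fderiv ℂ R (z, star z) (0, Pi.single j 1) := by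
  rw [wirtDbar, fderiv_dbl R z hR, fderiv_dbl R z hR, star_single1, star_singleI, single_I, split_pair,
    split_pair _ (Complex.I • _), smul_pair1, smul_pair2]
  simp only [smul_eq_mul]
  linear_combination ((1/2) * (fderiv ℂ R (z, star z) (Pi.single j 1, 0)) - (1/2) * fderiv ℂ R (z, star z) (0, Pi.single j 1)) * Complex.I_sq

theorem wirtD_congr {N : ℕ} {f g : (Fin N → ℂ) → ℂ} {z : Fin N → ℂ} (h : f =ᶠ[𝓝 z] g) (j : Fin N) :
    wirtD N j f z = wirtD N j g z := by
  rw [wirtD, wirtD, h.fderiv_eq]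

theorem wirtDbar_congr {N : ℕ} {f g : (Fin N → ℂ) → ℂ} {z : Fin N → ℂ} (h : f =ᶠ[𝓝 z] g) (j : Fin N) :
    wirtDbar N j f z = wirtDbar N j g z := by
  rw [wirtDbar, wirtDbar, h.fderiv_eq]

theorem vec_sum {N : ℕ} (v : Fin N → ℂ) : v = ∑ j, v j • (Pi.single j (1:ℂ) : Fin N → ℂ) := by
  exact pi_eq_sum_univ' v

theorem D_sum1 {N : ℕ} {W F : Type*} [NormedAddCommGroup W] [NormedSpace ℂ W] [NormedAddCommGroup F]
    [NormedSpace ℂ F] (D : (Fin N → ℂ) × W →L[ℂ] F) (v : Fin N → ℂ) :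
    D (v, 0) = ∑ j, v j • D (Pi.single j 1, 0) := by
  have : D (v, 0) = (D.comp (ContinuousLinearMap.inl ℂ _ _)) v := by simp
  rw [this]; conv_lhs => rw [vec_sum v]
  rw [map_sum]; simp

theorem D_sum2 {N : ℕ} {W F : Type*} [NormedAddCommGroup W] [NormedSpace ℂ W] [NormedAddCommGroup F]
    [NormedSpace ℂ F] (D : W × (Fin N → ℂ) →L[ℂ] F) (v : Fin N → ℂ) :
    D (0, v) = ∑ j, v j • D (0, Pi.single j 1) := by
  have : D (0, v) = (D.comp (ContinuousLinearMap.inr ℂ _ _)) v := by simp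
  rw [this]; conv_lhs => rw [vec_sum v]
  rw [map_sum]; simp

theorem conj_wirt {N : ℕ} (r : (Fin N → ℂ) → ℝ) (z : Fin N → ℂ) (hr : DifferentiableAt ℝ r z) (j : Fin N) :
    wirtD N j (fun x => (r x : ℂ)) z = star (wirtDbar N j (fun x => (r x : ℂ)) z) := by
  have h : ∀ v, fderiv ℝ (fun x => (r x : ℂ)) z v = ((fderiv ℝ r z v : ℝ) : ℂ) := by
    intro v
    have : HasFDerivAt (fun x => (r x : ℂ)) (Complex.ofRealCLM.comp (fderiv ℝ r z)) z :=
      Complex.ofRealCLM.hasFDerivAt.comp z hr.hasFDerivAt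
    rw [this.fderiv]; simp
  simp only [wirtD, wirtDbar, h]
  simp; ring

theorem local_picture (n : ℕ) (r : (Fin (n+1) → ℂ) → ℝ) (p : Fin (n+1) → ℂ) (hr : AnalyticAt ℝ r p)
    (hr0 : r p = 0) (hdr : fderiv ℝ r p ≠ 0) (hLevi : LeviNondeg (n+1) r p) :
    ∃ (j0 : Fin (n+1)) (Θ : (Fin (n+1) → ℂ) × (Fin n → ℂ) → ℂ),
      AnalyticAt ℂ Θ (sharp j0 p) ∧ Θ (sharp j0 p) = star (p j0) ∧
      (∀ᶠ z in 𝓝 p, r z = 0 ↔ star (z j0) = Θ (sharp j0 z)) ∧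
      (fderiv ℝ r p (Pi.single j0 1) ≠ 0 ∨ fderiv ℝ r p (Pi.single j0 Complex.I) ≠ 0) ∧
      (∀ v : Fin (n+1) → ℂ, fderiv ℂ Θ (sharp j0 p) (v, 0) = 0 →
        (∀ u : Fin n → ℂ, fderiv ℂ (fun x => fderiv ℂ Θ x (v, 0)) (sharp j0 p) (0, u) = 0) → v = 0) := by
  obtain ⟨R, hR, hRr⟩ := complexify (n+1) r p hr
  have hRr' : (fun x => ((r x : ℝ) : ℂ)) =ᶠ[𝓝 p] (fun z => R (z, star z)) := by
    filter_upwards [hRr] with z hz using hz.symm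
  have hcont : Continuous (fun z : Fin (n+1) → ℂ => (z, star z)) := by fun_prop
  have hRan : ∀ᶠ z in 𝓝 p, AnalyticAt ℂ R (z, star z) :=
    (hcont.tendsto p).eventually hR.eventually_analyticAt
  set D := fderiv ℂ R (p, star p) with hD
  have hwD : ∀ j, wirtD (n+1) j (fun x => (r x : ℂ)) p = D (Pi.single j 1, 0) := fun j => by
    rw [wirtD_congr hRr' j, wirtD_dbl R p hR.differentiableAt]
  have hwDb : ∀ j, wirtDbar (n+1) j (fun x => (r x : ℂ)) p = D (0, Pi.single j 1) := fun j => by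
    rw [wirtDbar_congr hRr' j, wirtDbar_dbl R p hR.differentiableAt]
  have hconj : ∀ j, D (Pi.single j 1, 0) = star (D (0, Pi.single j 1)) := fun j => by
    rw [← hwD, ← hwDb, conj_wirt r p hr.differentiableAt]
  have hconj2 : ∀ w : Fin (n+1) → ℂ, D (w, 0) = 0 → D (0, star w) = 0 := by
    intro w hw
    have : D (0, star w) = star (D (w, 0)) := by
      rw [D_sum1, D_sum2, star_sum]
      refine Finset.sum_congr rfl fun j _ => ?_
      rw [hconj]; simp
    rw [this, hw, star_zero]
  have hlevi : ∀ j k, leviMatrix (n+1) r p j k = fderiv ℂ (fderiv ℂ R) (p, star p) (Pi.single j 1, 0) (0, Pi.single k 1) := by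
    intro j k
    have h1 : (fun q => wirtDbar (n+1) k (fun x => (r x : ℂ)) q) =ᶠ[𝓝 p]
        fun q => (fun y => fderiv ℂ R y (0, Pi.single k 1)) (q, star q) := by
      filter_upwards [hRr'.eventually_nhds, hRan] with q hq1 hq2
      rw [wirtDbar_congr hq1, wirtDbar_dbl R q hq2.differentiableAt]
    rw [leviMatrix, wirtD_congr h1,
      wirtD_dbl (fun y => fderiv ℂ R y (0, Pi.single k 1)) p
        (hR.fderiv.differentiableAt.clm_apply (differentiableAt_const _)),
      fderiv_clm_apply hR.fderiv.differentiableAt (differentiableAt_const _)]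
    simp
  obtain ⟨j0, hj0⟩ : ∃ j0, D (0, Pi.single j0 1) ≠ 0 := by
    by_contra hcon
    push Not at hcon
    apply hdr
    ext v
    have h1 : fderiv ℝ (fun x => (r x : ℂ)) p v = ((fderiv ℝ r p v : ℝ) : ℂ) := by
      have : HasFDerivAt (fun x => (r x : ℂ)) (Complex.ofRealCLM.comp (fderiv ℝ r p)) p :=
        Complex.ofRealCLM.hasFDerivAt.comp p hr.differentiableAt.hasFDerivAt
      rw [this.fderiv]; simp
    rw [hRr'.fderiv_eq, fderiv_dbl R p hR.differentiableAt, split_pair, D_sum1, D_sum2] at h1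
    simp only [← hD, hconj, hcon] at h1
    simp at h1
    simpa using h1.symm
  set f : ((Fin (n+1) → ℂ) × (Fin n → ℂ)) × ℂ → ℂ := fun y => R (y.1.1, ins j0 (y.2, y.1.2)) with hf
  set x0 := sharp j0 p with hx0
  have hx0' : x0 = (p, rem j0 (star p)) := sharp_apply j0 p
  set u : ((Fin (n+1) → ℂ) × (Fin n → ℂ)) × ℂ := (x0, star (p j0)) with hu
  let T : ((Fin (n+1) → ℂ) × (Fin n → ℂ)) × ℂ →L[ℂ] (Fin (n+1) → ℂ) × (Fin (n+1) → ℂ) :=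
    ((ContinuousLinearMap.fst ℂ _ _).comp (ContinuousLinearMap.fst ℂ _ _)).prod
      ((ins j0).comp ((ContinuousLinearMap.snd ℂ _ _).prod
        ((ContinuousLinearMap.snd ℂ _ _).comp (ContinuousLinearMap.fst ℂ _ _))))
  have hT : ∀ y, T y = (y.1.1, ins j0 (y.2, y.1.2)) := fun y => by simp [T]
  have hTu : T u = (p, star p) := by
    rw [hT, hu, hx0']
    exact Prod.ext rfl (ins_rem j0 (star p))
  have hfT : f = fun y => R (T y) := by funext y; rw [hT]
  have hfan : AnalyticAt ℂ f u := by
    rw [hfT]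
    exact AnalyticAt.fun_comp (hTu ▸ hR) (T.analyticAt u)
  have hfu : f u = 0 := by
    rw [hfT]; simp only [hTu]; rw [hRr.self_of_nhds, hr0]; simp
  have hfd : HasFDerivAt f (D.comp T) u := by
    rw [hfT]
    refine HasFDerivAt.comp u ?_ T.hasFDerivAt
    rw [hTu]; exact hR.differentiableAt.hasFDerivAt
  have hinv : (fderiv ℂ f u ∘L .inr ℂ _ _).IsInvertible := by
    refine ⟨ContinuousLinearEquiv.unitsEquivAut ℂ (Units.mk0 _ hj0), ?_⟩
    ext
    rw [hfd.fderiv]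
    simp [hT, ins_s0]
  have cdf : ContDiffAt ℂ ⊤ f u := hfan.contDiffAt
  have pn : (⊤ : WithTop ℕ∞) ≠ 0 := by simp
  set Θ := cdf.implicitFunction pn hinv with hΘ
  have hΘan : AnalyticAt ℂ Θ x0 := (cdf.contDiffAt_implicitFunction pn hinv).analyticAt
  have hΘ0 : Θ x0 = star (p j0) := cdf.implicitFunction_apply_self pn hinv
  have hΘeq : ∀ᶠ x in 𝓝 x0, f (x, Θ x) = 0 := by
    have := cdf.eventually_apply_implicitFunction pn hinv
    rw [hfu] at this; exact this
  refine ⟨j0, Θ, hΘan, hΘ0, ?_, ?_, ?_⟩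
  · have h1 := cdf.eventually_apply_eq_iff_implicitFunction pn hinv
    have hc2 : Continuous (fun z : Fin (n+1) → ℂ => (sharp j0 z, star (z j0))) := by fun_prop
    have h2 := (hc2.tendsto p).eventually h1
    filter_upwards [h2, hRr] with z hz hz2
    have h3 : f (sharp j0 z, star (z j0)) = (r z : ℂ) := by
      rw [← hz2, hf, sharp_apply]
      simp only
      congr 2
      exact ins_rem j0 (star z)
    rw [h3, hfu] at hz
    rw [← Complex.ofReal_eq_zero, hz]
    exact eq_comm
  · by_contra hcon
    push Not at hcon
    apply hj0
    rw [← hwDb, wirtDbar]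
    have h : ∀ v, fderiv ℝ (fun x => (r x : ℂ)) p v = ((fderiv ℝ r p v : ℝ) : ℂ) := by
      intro v
      have : HasFDerivAt (fun x => (r x : ℂ)) (Complex.ofRealCLM.comp (fderiv ℝ r p)) p :=
        Complex.ofRealCLM.hasFDerivAt.comp p hr.differentiableAt.hasFDerivAt
      rw [this.fderiv]; simp
    rw [h, h, hcon.1, hcon.2]; simp
  · intro v hv1 hv2
    rw [← hx0] at hv1
    simp only [← hx0] at hv2
    set σ : (Fin (n+1) → ℂ) × (Fin n → ℂ) → (Fin (n+1) → ℂ) × (Fin (n+1) → ℂ) := fun x => T (x, Θ x) with hσ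
    have hσ0 : σ x0 = (p, star p) := by
      rw [hσ]; simp only [hΘ0]; exact hTu
    have hσan : AnalyticAt ℂ σ x0 :=
      AnalyticAt.fun_comp (T.analyticAt _) (analyticAt_id.prod hΘan)
    have hσd : ∀ x, AnalyticAt ℂ Θ x → HasFDerivAt σ (T.comp ((ContinuousLinearMap.id ℂ _).prod (fderiv ℂ Θ x))) x := by
      intro x hx
      exact T.hasFDerivAt.comp x ((hasFDerivAt_id x).prodMk hx.differentiableAt.hasFDerivAt)
    have hRσ : ∀ᶠ x in 𝓝 x0, R (σ x) = 0 := by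
      filter_upwards [hΘeq] with x hx
      rw [hfT] at hx; exact hx
    have hRσan : ∀ᶠ x in 𝓝 x0, AnalyticAt ℂ R (σ x) :=
      hσan.continuousAt.eventually (hσ0.symm ▸ hR.eventually_analyticAt)
    have hdiff : ∀ᶠ x in 𝓝 x0, ∀ a b, fderiv ℂ R (σ x) (a, ins j0 (fderiv ℂ Θ x (a, b), b)) = 0 := by
      filter_upwards [hRσ.eventually_nhds, hΘan.eventually_analyticAt, hRσan] with x h1 h2 h3 a b
      have h4 : HasFDerivAt (fun x => R (σ x)) _ x :=
        HasFDerivAt.comp x h3.differentiableAt.hasFDerivAt (hσd x h2)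
      have h5 : HasFDerivAt (fun x => R (σ x)) (0 : _ →L[ℂ] ℂ) x :=
        (hasFDerivAt_const (0:ℂ) x).congr_of_eventuallyEq h1
      have h6 := congrArg (fun L => L (a, b)) (h4.unique h5)
      simpa [hT] using h6
    have hA : ∀ᶠ x in 𝓝 x0, fderiv ℂ R (σ x) (v, 0) + fderiv ℂ Θ x (v, 0) * fderiv ℂ R (σ x) (0, Pi.single j0 1) = 0 := by
      filter_upwards [hdiff] with x hx
      have := hx v 0
      rw [ins_s0, split_pair, smul_pair2] at this
      exact this
    have hD0 : D (v, 0) = 0 := by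
      have := hA.self_of_nhds
      rw [hv1, hσ0] at this
      simpa using this
    have hvT : v ∈ complexTangent (n+1) r p := by
      rw [complexTangent, Set.mem_ofPred_eq, ← hD0, D_sum1]
      refine Finset.sum_congr rfl fun j _ => ?_
      rw [hwD, smul_eq_mul, mul_comm]
    have hDD : ∀ u : Fin n → ℂ, fderiv ℂ (fderiv ℂ R) (p, star p) (0, ins j0 (fderiv ℂ Θ x0 (0, u), u)) (v, 0) = 0 := by
      intro u
      have hRfd : HasFDerivAt (fderiv ℂ R) (fderiv ℂ (fderiv ℂ R) (p, star p)) (σ x0) := by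
        rw [hσ0]; exact hR.fderiv.differentiableAt.hasFDerivAt
      have h1 : HasFDerivAt (fun x => fderiv ℂ R (σ x)) _ x0 := hRfd.comp x0 (hσd x0 hΘan)
      have h2 := h1.clm_apply (hasFDerivAt_const ((v, 0) : (Fin (n+1) → ℂ) × (Fin (n+1) → ℂ)) x0)
      have h3 := h1.clm_apply (hasFDerivAt_const ((0, Pi.single j0 1) : (Fin (n+1) → ℂ) × (Fin (n+1) → ℂ)) x0)
      have h4 : HasFDerivAt (fun x => fderiv ℂ Θ x (v, 0)) _ x0 :=
        (hΘan.fderiv.differentiableAt.clm_apply (differentiableAt_const _)).hasFDerivAt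
      have h5 := h2.add (h4.mul h3)
      have h6 : HasFDerivAt (fun x => fderiv ℂ R (σ x) (v, 0) + fderiv ℂ Θ x (v, 0) * fderiv ℂ R (σ x) (0, Pi.single j0 1)) (0 : _ →L[ℂ] ℂ) x0 :=
        (hasFDerivAt_const (0:ℂ) x0).congr_of_eventuallyEq hA
      have h7 := congrArg (fun L => L (0, u)) (h5.unique h6)
      simpa [hT, hv1, hv2] using h7
    refine hLevi v hvT fun w hw => ?_
    have hw0 : D (w, 0) = 0 := by
      rw [complexTangent, Set.mem_ofPred_eq] at hw
      rw [← hw, D_sum1]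
      refine Finset.sum_congr rfl fun j _ => ?_
      rw [hwD, smul_eq_mul, mul_comm]
    have hw1 := hconj2 w hw0
    have hw2 := hdiff.self_of_nhds 0 (rem j0 (star w))
    rw [hσ0] at hw2
    have hins : ∀ s t : ℂ, ∀ y, ins j0 (s, y) = ins j0 (t, y) + (s - t) • Pi.single j0 1 := by
      intro s t y
      rw [← ins_s0, ← map_add]; simp
    have hwins : star w = ins j0 (fderiv ℂ Θ x0 (0, rem j0 (star w)), rem j0 (star w)) := by
      have h1 := ins_rem j0 (star w)
      rw [hins _ (fderiv ℂ Θ x0 (0, rem j0 (star w)))] at h1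
      rw [← h1] at hw1
      have h2 : ∀ a b : Fin (n+1) → ℂ, D (0, a + b) = D (0, a) + D (0, b) := by
        intro a b; rw [← map_add]; simp
      rw [h2, hw2, smul_pair2, zero_add, smul_eq_zero] at hw1
      have h3 := hw1.resolve_right hj0
      rw [h3] at h1
      simpa using h1.symm
    have hfin := hDD (rem j0 (star w))
    rw [← hwins] at hfin
    have hsymm : IsSymmSndFDerivAt ℂ R (p, star p) := by
      refine (hR.contDiffAt (n := ⊤)).isSymmSndFDerivAt ?_
      simp
    rw [hsymm] at hfin
    rw [← hfin]
    rw [D_sum1]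
    simp only [D_sum2 _ (star w), sum_apply, smul_apply, hlevi]
    rw [Finset.sum_comm]
    refine Finset.sum_congr rfl fun j _ => ?_
    rw [Finset.smul_sum]
    refine Finset.sum_congr rfl fun k _ => ?_
    simp only [smul_eq_mul, Pi.star_apply]
    rw [Complex.star_def]; ring

end Sph
end

section
open Topology Filter Metric

namespace Sph

/-- directional derivative -/
noncomputable def dd {X : Type} [NormedAddCommGroup X] [NormedSpace ℂ X] (F : X → ℂ) (v : X) (x : X) : ℂ :=
  fderiv ℂ F x v

section dd
variable {X : Type} [NormedAddCommGroup X] [NormedSpace ℂ X]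

theorem an_dd {F : X → ℂ} {x : X} (hF : AnalyticAt ℂ F x) (v : X) : AnalyticAt ℂ (dd F v) x :=
  ((ContinuousLinearMap.apply ℂ ℂ v).analyticAt _).comp hF.fderiv

theorem anOn_dd {F : X → ℂ} {U : Set X} (hF : AnalyticOnNhd ℂ F U) (v : X) : AnalyticOnNhd ℂ (dd F v) U :=
  fun x hx => an_dd (hF x hx) v

theorem dd_add {F G : X → ℂ} {x : X} (hF : AnalyticAt ℂ F x) (hG : AnalyticAt ℂ G x) (v : X) :
    dd (fun y => F y + G y) v x = dd F v x + dd G v x := by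
  have := (hF.differentiableAt.hasFDerivAt.add hG.differentiableAt.hasFDerivAt).fderiv
  unfold dd
  change (fderiv ℂ (F + G) x) v = _
  rw [this]; simp

theorem dd_mul {F G : X → ℂ} {x : X} (hF : AnalyticAt ℂ F x) (hG : AnalyticAt ℂ G x) (v : X) :
    dd (fun y => F y * G y) v x = dd F v x * G x + F x * dd G v x := by
  have := (hF.differentiableAt.hasFDerivAt.mul hG.differentiableAt.hasFDerivAt).fderiv
  unfold dd
  change (fderiv ℂ (F * G) x) v = _
  rw [this]; simp; ring

theorem dd_sum {ι : Type} (s : Finset ι) {F : ι → X → ℂ} {x : X} (hF : ∀ i ∈ s, AnalyticAt ℂ (F i) x) (v : X) :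
    dd (fun y => ∑ i ∈ s, F i y) v x = ∑ i ∈ s, dd (F i) v x := by
  have := (HasFDerivAt.fun_sum (fun i hi => (hF i hi).differentiableAt.hasFDerivAt)).fderiv
  unfold dd
  rw [this]; simp

theorem dd_const (c : ℂ) (v x : X) : dd (fun _ => c) v x = 0 := by
  simp [dd]

theorem dd_congr {F G : X → ℂ} {x : X} (h : F =ᶠ[𝓝 x] G) (v : X) : dd F v x = dd G v x := by
  unfold dd; rw [h.fderiv_eq]

theorem dd_congrOn {F G : X → ℂ} {U : Set X} (hU : IsOpen U) (h : ∀ x ∈ U, F x = G x) (v : X) :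
    ∀ x ∈ U, dd F v x = dd G v x := fun x hx =>
  dd_congr (by filter_upwards [hU.mem_nhds hx] with y hy using h y hy) v

theorem dd_comm {F : X → ℂ} {x : X} (hF : AnalyticAt ℂ F x) (v w : X) :
    dd (dd F v) w x = dd (dd F w) v x := by
  have h : ∀ v w, dd (dd F v) w x = fderiv ℂ (fderiv ℂ F) x w v := by
    intro v w
    unfold dd
    rw [fderiv_clm_apply hF.fderiv.differentiableAt (differentiableAt_const _)]
    simp
  have hs : IsSymmSndFDerivAt ℂ F x := (hF.contDiffAt (n := ⊤)).isSymmSndFDerivAt (by simp)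
  rw [h, h, hs]

theorem an_sum {ι : Type} (s : Finset ι) {F : ι → X → ℂ} {x : X} (hF : ∀ i ∈ s, AnalyticAt ℂ (F i) x) :
    AnalyticAt ℂ (fun y => ∑ i ∈ s, F i y) x := Finset.analyticAt_fun_sum s hF

theorem an_det {m : ℕ} {A : X → Matrix (Fin m) (Fin m) ℂ} {x : X} (hA : ∀ i j, AnalyticAt ℂ (fun y => A y i j) x) :
    AnalyticAt ℂ (fun y => (A y).det) x := by
  simp only [Matrix.det_apply']
  exact an_sum _ fun σ _ => analyticAt_const.mul (Finset.analyticAt_fun_prod _ fun i _ => hA _ _)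

theorem an_inv {m : ℕ} {A : X → Matrix (Fin m) (Fin m) ℂ} {x : X} (hA : ∀ i j, AnalyticAt ℂ (fun y => A y i j) x)
    (hd : (A x).det ≠ 0) (i j : Fin m) : AnalyticAt ℂ (fun y => (A y)⁻¹ i j) x := by
  simp only [Matrix.inv_def, Matrix.smul_apply, Ring.inverse_eq_inv', smul_eq_mul, Matrix.adjugate_apply]
  refine ((an_det hA).inv hd).mul (an_det fun k l => ?_)
  by_cases hk : k = j
  · subst hk; simp only [Matrix.updateRow_self]; exact analyticAt_const
  · simp only [Matrix.updateRow_ne hk]; exact hA k l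

end dd

section core
variable {n : ℕ}

/-- unit vectors -/
noncomputable def ez (i : Fin (n+1)) : (Fin (n+1) → ℂ) × (Fin n → ℂ) := (Pi.single i 1, 0)
/-- unit vectors -/
noncomputable def ew (a : Fin n) : (Fin (n+1) → ℂ) × (Fin n → ℂ) := (0, Pi.single a 1)

/-- `∂̃_a`, identity for `a = 0`. -/
noncomputable def dt (F : (Fin (n+1) → ℂ) × (Fin n → ℂ) → ℂ) (a : Fin (n+1)) (x : (Fin (n+1) → ℂ) × (Fin n → ℂ)) : ℂ :=
  Fin.cases (motive := fun _ => ℂ) (F x) (fun α => dd F (ew α) x) a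

theorem an_dt {F : (Fin (n+1) → ℂ) × (Fin n → ℂ) → ℂ} {x} (hF : AnalyticAt ℂ F x) (a : Fin (n+1)) :
    AnalyticAt ℂ (dt F a) x := by
  refine Fin.cases ?_ (fun α => ?_) a
  · exact hF
  · exact an_dd hF _

variable (Θ : (Fin (n+1) → ℂ) × (Fin n → ℂ) → ℂ)

/-- Levi-type matrix -/
noncomputable def Pm (x : (Fin (n+1) → ℂ) × (Fin n → ℂ)) : Matrix (Fin (n+1)) (Fin (n+1)) ℂ :=
  Matrix.of fun a k => dt (dd Θ (ez k)) a x

noncomputable def Sh (l i j : Fin (n+1)) (x : (Fin (n+1) → ℂ) × (Fin n → ℂ)) : ℂ :=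
  ∑ a, (Pm Θ x)⁻¹ l a * dt (dd (dd Θ (ez i)) (ez j)) a x

noncomputable def Th (j : Fin (n+1)) (x : (Fin (n+1) → ℂ) × (Fin n → ℂ)) : ℂ :=
  ∑ i, Sh Θ i i j x

noncomputable def kh (x : (Fin (n+1) → ℂ) × (Fin n → ℂ)) : ℂ :=
  (-(2*n+2 : ℂ)⁻¹) * (∑ α, ∑ j, dd (Th Θ j) (ew α) x * (Pm Θ x)⁻¹ j (Fin.succ α))

noncomputable def ah (j : Fin (n+1)) (x : (Fin (n+1) → ℂ) × (Fin n → ℂ)) : ℂ :=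
  (-(n+2 : ℂ)⁻¹) * (Th Θ j x + kh Θ x * dd Θ (ez j) x)

noncomputable def ch (a : Fin (n+1) → (Fin (n+1) → ℂ) × (Fin n → ℂ) → ℂ) (l j : Fin (n+1)) (x : (Fin (n+1) → ℂ) × (Fin n → ℂ)) : ℂ :=
  ∑ α, (Pm Θ x)⁻¹ l (Fin.succ α) * dd (a j) (ew α) x

noncomputable def Gh0 (a : Fin (n+1) → (Fin (n+1) → ℂ) × (Fin n → ℂ) → ℂ) (l i j : Fin (n+1))
    (x : (Fin (n+1) → ℂ) × (Fin n → ℂ)) : ℂ :=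
  Sh Θ l i j x + a j x * (if l = i then 1 else 0) + a i x * (if l = j then 1 else 0)
    + ch Θ a l j x * dd Θ (ez i) x + ch Θ a l i x * dd Θ (ez j) x

noncomputable def Gh (l i j : Fin (n+1)) (x : (Fin (n+1) → ℂ) × (Fin n → ℂ)) : ℂ := Gh0 Θ (ah Θ) l i j x

variable {Θ}

theorem an_Pm {x} (hΘ : AnalyticAt ℂ Θ x) (a k : Fin (n+1)) : AnalyticAt ℂ (fun y => Pm Θ y a k) x :=
  an_dt (an_dd hΘ _) a

theorem an_Pinv {x} (hΘ : AnalyticAt ℂ Θ x) (hd : (Pm Θ x).det ≠ 0) (a k : Fin (n+1)) :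
    AnalyticAt ℂ (fun y => (Pm Θ y)⁻¹ a k) x := an_inv (fun i j => an_Pm hΘ i j) hd a k

theorem an_Sh {x} (hΘ : AnalyticAt ℂ Θ x) (hd : (Pm Θ x).det ≠ 0) (l i j : Fin (n+1)) :
    AnalyticAt ℂ (Sh Θ l i j) x :=
  an_sum _ fun a _ => (an_Pinv hΘ hd l a).mul (an_dt (an_dd (an_dd hΘ _) _) a)

theorem an_Th {x} (hΘ : AnalyticAt ℂ Θ x) (hd : (Pm Θ x).det ≠ 0) (j : Fin (n+1)) :
    AnalyticAt ℂ (Th Θ j) x := an_sum _ fun i _ => an_Sh hΘ hd i i j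

theorem an_kh {x} (hΘ : AnalyticAt ℂ Θ x) (hd : (Pm Θ x).det ≠ 0) : AnalyticAt ℂ (kh Θ) x :=
  analyticAt_const.mul (an_sum _ fun α _ => an_sum _ fun j _ => (an_dd (an_Th hΘ hd j) _).mul (an_Pinv hΘ hd _ _))

theorem an_ah {x} (hΘ : AnalyticAt ℂ Θ x) (hd : (Pm Θ x).det ≠ 0) (j : Fin (n+1)) : AnalyticAt ℂ (ah Θ j) x :=
  analyticAt_const.mul ((an_Th hΘ hd j).add ((an_kh hΘ hd).mul (an_dd hΘ _)))

theorem an_ch {a : Fin (n+1) → (Fin (n+1) → ℂ) × (Fin n → ℂ) → ℂ} {x} (hΘ : AnalyticAt ℂ Θ x) (hd : (Pm Θ x).det ≠ 0)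
    (ha : ∀ j, AnalyticAt ℂ (a j) x) (l j : Fin (n+1)) : AnalyticAt ℂ (ch Θ a l j) x :=
  an_sum _ fun α _ => (an_Pinv hΘ hd _ _).mul (an_dd (ha j) _)

theorem an_Gh {x} (hΘ : AnalyticAt ℂ Θ x) (hd : (Pm Θ x).det ≠ 0) (l i j : Fin (n+1)) : AnalyticAt ℂ (Gh Θ l i j) x :=
  ((((an_Sh hΘ hd l i j).add ((an_ah hΘ hd j).mul analyticAt_const)).add ((an_ah hΘ hd i).mul analyticAt_const)).add
    ((an_ch hΘ hd (an_ah hΘ hd) l j).mul (an_dd hΘ _))).add ((an_ch hΘ hd (an_ah hΘ hd) l i).mul (an_dd hΘ _))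

theorem Q_zero {x} (hd : (Pm Θ x).det ≠ 0) (α : Fin n) :
    ∑ j, dd Θ (ez j) x * (Pm Θ x)⁻¹ j α.succ = 0 := by
  have h := Matrix.mul_nonsing_inv (Pm Θ x) (isUnit_iff_ne_zero.2 hd)
  have h2 := congrFun (congrFun h 0) α.succ
  rw [Matrix.mul_apply, Matrix.one_apply_ne (Fin.succ_ne_zero α).symm] at h2
  exact h2

theorem Q_succ {x} (hd : (Pm Θ x).det ≠ 0) (α : Fin n) :
    ∑ j, dd (dd Θ (ez j)) (ew α) x * (Pm Θ x)⁻¹ j α.succ = 1 := by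
  have h := Matrix.mul_nonsing_inv (Pm Θ x) (isUnit_iff_ne_zero.2 hd)
  have h2 := congrFun (congrFun h α.succ) α.succ
  rw [Matrix.mul_apply, Matrix.one_apply_eq] at h2
  exact h2

theorem Q_left {x} (hd : (Pm Θ x).det ≠ 0) (l k : Fin (n+1)) :
    ∑ a, (Pm Θ x)⁻¹ l a * Pm Θ x a k = if l = k then 1 else 0 := by
  have h := Matrix.nonsing_inv_mul (Pm Θ x) (isUnit_iff_ne_zero.2 hd)
  have h2 := congrFun (congrFun h l) k
  rw [Matrix.mul_apply, Matrix.one_apply] at h2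
  exact h2

theorem gamma_eq0 {U : Set ((Fin (n+1) → ℂ) × (Fin n → ℂ))} (hU : IsOpen U) (hΘ : AnalyticOnNhd ℂ Θ U)
    (hd : ∀ x ∈ U, (Pm Θ x).det ≠ 0) (a : Fin (n+1) → (Fin (n+1) → ℂ) × (Fin n → ℂ) → ℂ)
    (ha : ∀ j, AnalyticOnNhd ℂ (a j) U)
    (Γ : Fin (n+1) → Fin (n+1) → Fin (n+1) → (Fin (n+1) → ℂ) × (Fin n → ℂ) → ℂ)
    (hΓ : ∀ l i j, AnalyticOnNhd ℂ (Γ l i j) U) (hΓw : ∀ l i j α, ∀ x ∈ U, dd (Γ l i j) (ew α) x = 0)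
    (heq : ∀ i j, ∀ x ∈ U, dd (dd Θ (ez i)) (ez j) x + a j x * dd Θ (ez i) x + a i x * dd Θ (ez j) x
      = ∑ k, Γ k i j x * dd Θ (ez k) x) (l i j : Fin (n+1)) :
    ∀ x ∈ U, Γ l i j x = Gh0 Θ a l i j x := by
  intro x hx
  let da : Fin (n+1) → Fin (n+1) → ℂ := fun j b => Fin.cases (motive := fun _ => ℂ) 0 (fun α => dd (a j) (ew α) x) b
  have key : ∀ b, dt (dd (dd Θ (ez i)) (ez j)) b x + a j x * Pm Θ x b i + a i x * Pm Θ x b j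
      + da j b * dd Θ (ez i) x + da i b * dd Θ (ez j) x = ∑ k, Γ k i j x * Pm Θ x b k := by
    intro b
    refine Fin.cases ?_ (fun α => ?_) b
    · have := heq i j x hx
      simpa [dt, Pm, da] using this
    · have h1 := dd_congrOn hU (heq i j) (ew α) x hx
      have hz : ∀ k, AnalyticAt ℂ (dd Θ (ez k)) x := fun k => an_dd (hΘ x hx) _
      rw [dd_add ((an_dd (hz i) (ez j)).fun_add ((ha j x hx).fun_mul (hz i))) ((ha i x hx).fun_mul (hz j)),
        dd_add (an_dd (hz i) (ez j)) ((ha j x hx).fun_mul (hz i)), dd_mul (ha j x hx) (hz i),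
        dd_mul (ha i x hx) (hz j), dd_sum _ (fun k _ => (hΓ k i j x hx).fun_mul (hz k))] at h1
      simp only [dd_mul (hΓ _ i j x hx) (hz _), hΓw _ _ _ _ x hx, zero_mul, zero_add] at h1
      simp only [dt, Pm, da, Fin.cases_succ, Matrix.of_apply]
      rw [← h1]; ring
  have h2 : ∑ b, (Pm Θ x)⁻¹ l b * (∑ k, Γ k i j x * Pm Θ x b k) = Γ l i j x := by
    calc ∑ b, (Pm Θ x)⁻¹ l b * (∑ k, Γ k i j x * Pm Θ x b k)
        = ∑ k, Γ k i j x * ∑ b, (Pm Θ x)⁻¹ l b * Pm Θ x b k := by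
          simp only [Finset.mul_sum]; rw [Finset.sum_comm]
          exact Finset.sum_congr rfl fun k _ => Finset.sum_congr rfl fun b _ => by ring
      _ = Γ l i j x := by simp [Q_left (hd x hx)]
  have hda : ∀ j, ∑ b, (Pm Θ x)⁻¹ l b * da j b = ch Θ a l j x := by
    intro j
    rw [Fin.sum_univ_succ]; simp [da, ch]
  rw [← h2]
  simp only [← key, mul_add, Finset.sum_add_distrib]
  rw [Gh0, ← hda j, ← hda i, ← Q_left (hd x hx), ← Q_left (hd x hx), Sh]
  simp only [Finset.mul_sum, Finset.sum_mul]
  congr 1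
  congr 1
  congr 1
  congr 1
  all_goals exact Finset.sum_congr rfl fun b _ => by ring

theorem gamma_eq {U : Set ((Fin (n+1) → ℂ) × (Fin n → ℂ))} (hU : IsOpen U) (hΘ : AnalyticOnNhd ℂ Θ U)
    (hd : ∀ x ∈ U, (Pm Θ x).det ≠ 0) (a : Fin (n+1) → (Fin (n+1) → ℂ) × (Fin n → ℂ) → ℂ)
    (ha : ∀ j, AnalyticOnNhd ℂ (a j) U)
    (Γ : Fin (n+1) → Fin (n+1) → Fin (n+1) → (Fin (n+1) → ℂ) × (Fin n → ℂ) → ℂ)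
    (hΓ : ∀ l i j, AnalyticOnNhd ℂ (Γ l i j) U) (hΓw : ∀ l i j α, ∀ x ∈ U, dd (Γ l i j) (ew α) x = 0)
    (htr : ∀ j, ∀ x ∈ U, ∑ i, Γ i i j x = 0)
    (heq : ∀ i j, ∀ x ∈ U, dd (dd Θ (ez i)) (ez j) x + a j x * dd Θ (ez i) x + a i x * dd Θ (ez j) x
      = ∑ k, Γ k i j x * dd Θ (ez k) x) (l i j : Fin (n+1)) :
    ∀ x ∈ U, Γ l i j x = Gh Θ l i j x := by
  have h0 := gamma_eq0 hU hΘ hd a ha Γ hΓ hΓw heq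
  have hchz : ∀ j, ∀ x ∈ U, ∑ i, ch Θ a i j x * dd Θ (ez i) x = 0 := by
    intro j x hx
    simp only [ch, Finset.sum_mul]
    rw [Finset.sum_comm]
    refine Finset.sum_eq_zero fun α _ => ?_
    calc ∑ y, (Pm Θ x)⁻¹ y α.succ * dd (a j) (ew α) x * dd Θ (ez y) x
        = dd (a j) (ew α) x * ∑ y, dd Θ (ez y) x * (Pm Θ x)⁻¹ y α.succ := by
          rw [Finset.mul_sum]; exact Finset.sum_congr rfl fun _ _ => by ring
      _ = 0 := by rw [Q_zero (hd x hx), mul_zero]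
  let κ : (Fin (n+1) → ℂ) × (Fin n → ℂ) → ℂ := fun x => ∑ i, ch Θ a i i x
  have hκ : AnalyticOnNhd ℂ κ U := fun x hx => an_sum _ fun i _ => an_ch (hΘ x hx) (hd x hx) (fun j => ha j x hx) i i
  have htr2 : ∀ j, ∀ x ∈ U, Th Θ j x + (n+2) * a j x + κ x * dd Θ (ez j) x = 0 := by
    intro j x hx
    rw [← htr j x hx]
    simp only [h0 _ _ _ x hx, Gh0, Finset.sum_add_distrib, hchz j x hx]
    simp [Th, κ, Finset.sum_mul]
    ring
  have hκeq : ∀ x ∈ U, κ x = kh Θ x := by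
    intro x hx
    have h1 : ∀ j α, dd (Th Θ j) (ew α) x + (n+2) * dd (a j) (ew α) x + (dd κ (ew α) x * dd Θ (ez j) x
        + κ x * dd (dd Θ (ez j)) (ew α) x) = 0 := by
      intro j α
      have hT := an_Th (hΘ x hx) (hd x hx) j
      have hz := an_dd (hΘ x hx) (ez j)
      have h2 := dd_congrOn hU (htr2 j) (ew α) x hx
      have hc : AnalyticAt ℂ (fun _ : (Fin (n+1) → ℂ) × (Fin n → ℂ) => (n + 2 : ℂ)) x := analyticAt_const
      rw [dd_add (hT.fun_add (hc.fun_mul (ha j x hx))) ((hκ x hx).fun_mul hz),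
        dd_add hT (hc.fun_mul (ha j x hx)), dd_mul hc (ha j x hx), dd_mul (hκ x hx) hz,
        dd_const, dd_const] at h2
      rw [← h2]; ring
    have h3 : ∑ α, ∑ j, (dd (Th Θ j) (ew α) x + (n+2) * dd (a j) (ew α) x + (dd κ (ew α) x * dd Θ (ez j) x
        + κ x * dd (dd Θ (ez j)) (ew α) x)) * (Pm Θ x)⁻¹ j (Fin.succ α) = 0 := by
      simp [h1]
    have h4 : ∑ α, ∑ j, (dd (Th Θ j) (ew α) x + (n+2) * dd (a j) (ew α) x + (dd κ (ew α) x * dd Θ (ez j) x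
        + κ x * dd (dd Θ (ez j)) (ew α) x)) * (Pm Θ x)⁻¹ j (Fin.succ α)
        = (∑ α, ∑ j, dd (Th Θ j) (ew α) x * (Pm Θ x)⁻¹ j (Fin.succ α))
          + (n+2) * (∑ α, ∑ j, (Pm Θ x)⁻¹ j (Fin.succ α) * dd (a j) (ew α) x)
          + ((∑ α, dd κ (ew α) x * ∑ j, dd Θ (ez j) x * (Pm Θ x)⁻¹ j (Fin.succ α))
          + κ x * ∑ α, ∑ j, dd (dd Θ (ez j)) (ew α) x * (Pm Θ x)⁻¹ j (Fin.succ α)) := by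
      simp only [Finset.mul_sum, ← Finset.sum_add_distrib]
      exact Finset.sum_congr rfl fun α _ => Finset.sum_congr rfl fun j _ => by ring
    have h5 : ∑ α, ∑ j, (Pm Θ x)⁻¹ j (Fin.succ α) * dd (a j) (ew α) x = κ x := by
      rw [Finset.sum_comm]; rfl
    rw [h4, h5] at h3
    simp only [Q_zero (hd x hx), Q_succ (hd x hx)] at h3
    have hne : (2*n+2 : ℂ) ≠ 0 := by exact_mod_cast (by omega : 2*n+2 ≠ 0)
    rw [kh]
    simp at h3
    have h6 : (∑ α, ∑ j, dd (Th Θ j) (ew α) x * (Pm Θ x)⁻¹ j (Fin.succ α)) = -((2*n+2) * κ x) := by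
      linear_combination h3
    rw [h6]; field_simp
  have haeq : ∀ j, ∀ x ∈ U, a j x = ah Θ j x := by
    intro j x hx
    have h1 := htr2 j x hx
    rw [hκeq x hx] at h1
    have hne : (n+2 : ℂ) ≠ 0 := by exact_mod_cast (by omega : n+2 ≠ 0)
    rw [ah]
    field_simp
    linear_combination h1
  intro x hx
  have hch : ∀ l j, ch Θ a l j x = ch Θ (ah Θ) l j x := by
    intro l j
    unfold ch
    refine Finset.sum_congr rfl fun α _ => ?_
    rw [dd_congrOn hU (haeq j) (ew α) x hx]
  rw [h0 l i j x hx, Gh, Gh0, Gh0, hch, hch, haeq j x hx, haeq i x hx]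

end core
end Sph
end

section
open Topology Filter Metric

namespace Sph

section jac
variable {X : Type} [NormedAddCommGroup X] [NormedSpace ℂ X]

theorem dd_prod {ι : Type} [DecidableEq ι] (s : Finset ι) {F : ι → X → ℂ} {x : X} (hF : ∀ i ∈ s, AnalyticAt ℂ (F i) x) (v : X) :
    dd (fun y => ∏ i ∈ s, F i y) v x = ∑ i ∈ s, (∏ j ∈ s.erase i, F j x) * dd (F i) v x := by
  have := (HasFDerivAt.finsetProd (fun i hi => (hF i hi).differentiableAt.hasFDerivAt)).fderiv
  unfold dd
  rw [this]; simp

theorem jacobi {m : ℕ} {A : X → Matrix (Fin m) (Fin m) ℂ} {x : X} (hA : ∀ i j, AnalyticAt ℂ (fun y => A y i j) x)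
    (v : X) (B : Matrix (Fin m) (Fin m) ℂ)
    (hB : ∀ i j, dd (fun y => A y i j) v x = (B * A x) i j) :
    dd (fun y => (A y).det) v x = B.trace * (A x).det := by
  have h1 : ∀ i, ((A x).updateRow i (∑ k, B i k • A x k)).det = B i i • (A x).det := fun i =>
    Matrix.det_updateRow_sum (A x) i (B i)
  rw [Matrix.trace, Finset.sum_mul]
  have h2 : ∀ i, Matrix.diag B i * (A x).det = ((A x).updateRow i (∑ k, B i k • A x k)).det := fun i => (h1 i).symm
  simp only [h2]
  have h3 : ∀ y, (A y).det = ∑ σ : Equiv.Perm (Fin m), ((Equiv.Perm.sign σ : ℤ) : ℂ) * ∏ i, A y i (σ i) := by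
    intro y
    rw [← Matrix.det_transpose, Matrix.det_apply']; rfl
  have h4 : ∀ C : Matrix (Fin m) (Fin m) ℂ, C.det = ∑ σ : Equiv.Perm (Fin m), ((Equiv.Perm.sign σ : ℤ) : ℂ) * ∏ i, C i (σ i) := by
    intro y
    rw [← Matrix.det_transpose, Matrix.det_apply']; rfl
  simp only [h3, h4]
  have hp : ∀ σ : Equiv.Perm (Fin m), AnalyticAt ℂ (fun y => ∏ i, A y i (σ i)) x := fun σ =>
    Finset.analyticAt_fun_prod _ fun i _ => hA _ _
  have hc : ∀ c : ℂ, AnalyticAt ℂ (fun _ : X => c) x := fun c => analyticAt_const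
  rw [dd_sum _ (fun σ _ => (hc _).fun_mul (hp σ)), Finset.sum_comm]
  refine Finset.sum_congr rfl fun σ _ => ?_
  rw [dd_mul (hc _) (hp σ), dd_const, zero_mul, zero_add, dd_prod _ (fun i _ => hA _ _), Finset.mul_sum]
  refine Finset.sum_congr rfl fun i _ => ?_
  congr 1
  rw [← Finset.mul_prod_erase _ _ (Finset.mem_univ i), mul_comm]
  congr 1
  · rw [hB, Matrix.updateRow_self, Matrix.mul_apply]; simp [Finset.sum_apply]
  · refine Finset.prod_congr rfl fun j hj => ?_
    rw [Matrix.updateRow_ne (Finset.ne_of_mem_erase hj)]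

end jac

section wr
variable {n : ℕ}

/-- unit vector -/
noncomputable def eu (i : Fin (n+1)) : Fin (n+1) → ℂ := Pi.single i 1

/-- Wronskian matrix -/
noncomputable def Wm (f : Fin (n+2) → (Fin (n+1) → ℂ) → ℂ) (z : Fin (n+1) → ℂ) : Matrix (Fin (n+2)) (Fin (n+2)) ℂ :=
  Matrix.of fun a c => Fin.cases (motive := fun _ => ℂ) (f c z) (fun i => dd (f c) (eu i) z) a

@[simp] theorem Wm_zero (f : Fin (n+2) → (Fin (n+1) → ℂ) → ℂ) (z c) : Wm f z 0 c = f c z := rfl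
@[simp] theorem Wm_succ (f : Fin (n+2) → (Fin (n+1) → ℂ) → ℂ) (z c i) : Wm f z (Fin.succ i) c = dd (f c) (eu i) z := rfl

variable {f : Fin (n+2) → (Fin (n+1) → ℂ) → ℂ}

theorem an_W {z} (hf : ∀ c, AnalyticAt ℂ (f c) z) (a c) : AnalyticAt ℂ (fun y => Wm f y a c) z := by
  refine Fin.cases ?_ (fun i => ?_) a
  · exact hf c
  · exact an_dd (hf c) _

variable (f) in
/-- derivative of W -/
noncomputable def dW (j : Fin (n+1)) (z : Fin (n+1) → ℂ) : Matrix (Fin (n+2)) (Fin (n+2)) ℂ :=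
  Matrix.of fun a c => dd (fun y => Wm f y a c) (eu j) z

variable (f) in
/-- connection matrix -/
noncomputable def Bm (j : Fin (n+1)) (z : Fin (n+1) → ℂ) : Matrix (Fin (n+2)) (Fin (n+2)) ℂ :=
  dW f j z * (Wm f z)⁻¹

theorem an_B {z} (hf : ∀ c, AnalyticAt ℂ (f c) z) (hd : (Wm f z).det ≠ 0) (j a b) :
    AnalyticAt ℂ (fun y => Bm f j y a b) z := by
  simp only [Bm, Matrix.mul_apply]
  exact an_sum _ fun c _ => (an_dd (an_W hf a c) _).fun_mul (an_inv (fun i j => an_W hf i j) hd c b)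

theorem dW_eq {z} (hd : (Wm f z).det ≠ 0) (j) : dW f j z = Bm f j z * Wm f z := by
  rw [Bm, Matrix.mul_assoc, Matrix.nonsing_inv_mul _ (isUnit_iff_ne_zero.2 hd), mul_one]

theorem Bm_zero {z} (hd : (Wm f z).det ≠ 0) (j a) : Bm f j z 0 a = if a = j.succ then 1 else 0 := by
  have h1 : dW f j z 0 = Wm f z j.succ := rfl
  have : Bm f j z 0 a = (Wm f z * (Wm f z)⁻¹) j.succ a := by
    rw [Bm, Matrix.mul_apply, Matrix.mul_apply, h1]
  rw [this, Matrix.mul_nonsing_inv _ (isUnit_iff_ne_zero.2 hd), Matrix.one_apply]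
  simp [eq_comm]

theorem Bm_trace {V : Set (Fin (n+1) → ℂ)} (hV : IsOpen V) (hf : ∀ c, AnalyticOnNhd ℂ (f c) V) (κ : ℂ) (hκ : κ ≠ 0)
    (hd : ∀ z ∈ V, (Wm f z).det = κ) (j) : ∀ z ∈ V, ∑ i : Fin (n+1), Bm f j z i.succ i.succ = 0 := by
  intro z hz
  have hd0 : (Wm f z).det ≠ 0 := by rw [hd z hz]; exact hκ
  have h1 := jacobi (fun a c => an_W (fun c => hf c z hz) a c) (eu j) (Bm f j z)
    (fun a c => congrFun (congrFun (dW_eq hd0 j) a) c)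
  rw [dd_congrOn hV hd _ z hz, dd_const] at h1
  have h2 := (mul_eq_zero.1 h1.symm).resolve_right hd0
  rw [Matrix.trace, Fin.sum_univ_succ] at h2
  simpa [Bm_zero hd0, Matrix.diag, (Fin.succ_ne_zero j).symm] using h2

theorem dd_dW {V : Set (Fin (n+1) → ℂ)} (hV : IsOpen V) (hf : ∀ c, AnalyticOnNhd ℂ (f c) V)
    (hd : ∀ z ∈ V, (Wm f z).det ≠ 0) (j l a b) : ∀ z ∈ V,
    dd (fun y => Bm f j y a b) (eu l) z + (Bm f j z * Bm f l z) a b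
     = dd (fun y => Bm f l y a b) (eu j) z + (Bm f l z * Bm f j z) a b := by
  intro z hz
  have hfz := fun c => hf c z hz
  have key : ∀ j l a c, dd (fun y => dW f j y a c) (eu l) z =
      ((Matrix.of (fun a b => dd (fun y => Bm f j y a b) (eu l) z) + Bm f j z * Bm f l z) * Wm f z) a c := by
    intro j l a c
    rw [dd_congrOn hV (fun y hy => congrFun (congrFun (dW_eq (hd y hy) j) a) c) (eu l) z hz]
    simp only [Matrix.mul_apply]
    rw [dd_sum _ (fun b _ => (an_B hfz (hd z hz) j a b).fun_mul (an_W hfz b c))]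
    simp only [dd_mul (an_B hfz (hd z hz) j a _) (an_W hfz _ c)]
    rw [Finset.sum_add_distrib]
    simp only [Matrix.add_apply, add_mul, Finset.sum_add_distrib, Matrix.of_apply]
    congr 1
    have h5 : ∀ b, dd (fun y => Wm f y b c) (eu l) z = (Bm f l z * Wm f z) b c :=
      fun b => congrFun (congrFun (dW_eq (hd z hz) l) b) c
    simp only [h5]
    rw [← Matrix.mul_apply, ← Matrix.mul_apply, Matrix.mul_assoc]
  have h6 : (Matrix.of (fun a b => dd (fun y => Bm f j y a b) (eu l) z) + Bm f j z * Bm f l z) * Wm f z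
     = (Matrix.of (fun a b => dd (fun y => Bm f l y a b) (eu j) z) + Bm f l z * Bm f j z) * Wm f z := by
    ext a c
    rw [← key, ← key]
    exact dd_comm (an_W hfz a c) _ _
  have h7 := congrArg (· * (Wm f z)⁻¹) h6
  simp only [Matrix.mul_assoc _ (Wm f z), Matrix.mul_nonsing_inv _ (isUnit_iff_ne_zero.2 (hd z hz)), mul_one] at h7
  exact congrFun (congrFun h7 a) b

/-- formula for the zeroth symbol -/
noncomputable def G0 (Γ : Fin (n+1) → Fin (n+1) → Fin (n+1) → (Fin (n+1) → ℂ) → ℂ) (l i j : Fin (n+1)) (z : Fin (n+1) → ℂ) : ℂ :=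
  dd (Γ l i l) (eu j) z + ∑ k, Γ k i l z * Γ l k j z - dd (Γ l i j) (eu l) z - ∑ k, Γ k i j z * Γ l k l z

/-- full connection matrix from symbols -/
noncomputable def Bh (Γ : Fin (n+1) → Fin (n+1) → Fin (n+1) → (Fin (n+1) → ℂ) → ℂ) (o : Fin (n+1) → Fin (n+1)) (j : Fin (n+1))
    (z : Fin (n+1) → ℂ) (a b : Fin (n+2)) : ℂ :=
  Fin.cases (motive := fun _ => ℂ) (if b = j.succ then 1 else 0)
    (fun i => Fin.cases (motive := fun _ => ℂ) (G0 Γ (o j) i j z) (fun k => Γ k i j z) b) a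

theorem Bm_eq_Bh {V : Set (Fin (n+1) → ℂ)} (hV : IsOpen V) (hf : ∀ c, AnalyticOnNhd ℂ (f c) V)
    (hd : ∀ z ∈ V, (Wm f z).det ≠ 0) (o : Fin (n+1) → Fin (n+1)) (ho : ∀ j, o j ≠ j)
    (Γ : Fin (n+1) → Fin (n+1) → Fin (n+1) → (Fin (n+1) → ℂ) → ℂ)
    (hΓ : ∀ l i j, ∀ z ∈ V, Bm f j z i.succ l.succ = Γ l i j z) (j a b) :
    ∀ z ∈ V, Bm f j z a b = Bh Γ o j z a b := by
  intro z hz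
  have hfz := fun c => hf c z hz
  refine Fin.cases ?_ (fun i => ?_) a
  · rw [Bm_zero (hd z hz)]; rfl
  · refine Fin.cases ?_ (fun k => ?_) b
    · have h := dd_dW hV hf hd j (o j) i.succ (o j).succ z hz
      rw [dd_congrOn hV (hΓ _ _ _) _ z hz, dd_congrOn hV (hΓ _ _ _) _ z hz] at h
      simp only [Matrix.mul_apply, Fin.sum_univ_succ (n := n+1), Bm_zero (hd z hz), hΓ _ _ _ z hz] at h
      have ho' : (o j).succ ≠ j.succ := fun h => ho j (Fin.succ_injective _ h)
      simp only [ho', if_true, if_false] at h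
      change _ = G0 Γ (o j) i j z
      rw [G0]
      linear_combination h
    · exact hΓ _ _ _ z hz

theorem an_Bh {Γ : Fin (n+1) → Fin (n+1) → Fin (n+1) → (Fin (n+1) → ℂ) → ℂ} {z} (hΓ : ∀ l i j, AnalyticAt ℂ (Γ l i j) z)
   (o : Fin (n+1) → Fin (n+1)) (j a b) : AnalyticAt ℂ (fun y => Bh Γ o j y a b) z := by
  refine Fin.cases ?_ (fun i => ?_) a
  · exact analyticAt_const
  · refine Fin.cases ?_ (fun k => ?_) b
    · exact (((an_dd (hΓ _ _ _) _).fun_add (an_sum _ fun k _ => (hΓ _ _ _).fun_mul (hΓ _ _ _))).fun_sub (an_dd (hΓ _ _ _) _)).fun_sub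
        (an_sum _ fun k _ => (hΓ _ _ _).fun_mul (hΓ _ _ _))
    · exact hΓ _ _ _

end wr

end Sph
end

section
open Topology Filter Metric

namespace Sph
section
variable {n : ℕ}

theorem an_fst {F : (Fin (n+1) → ℂ) → ℂ} {x : (Fin (n+1) → ℂ) × (Fin n → ℂ)} (hF : AnalyticAt ℂ F x.1) :
    AnalyticAt ℂ (fun y : (Fin (n+1) → ℂ) × (Fin n → ℂ) => F y.1) x :=
  hF.fun_comp_of_eq analyticAt_fst rfl

theorem dd_fst {F : (Fin (n+1) → ℂ) → ℂ} {x : (Fin (n+1) → ℂ) × (Fin n → ℂ)} (hF : AnalyticAt ℂ F x.1)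
    (v : (Fin (n+1) → ℂ) × (Fin n → ℂ)) :
    dd (fun y : (Fin (n+1) → ℂ) × (Fin n → ℂ) => F y.1) v x = dd F v.1 x.1 := by
  have := (hF.differentiableAt.hasFDerivAt.comp x (hasFDerivAt_fst (𝕜 := ℂ) (p := x))).fderiv
  unfold dd
  change (fderiv ℂ (F ∘ Prod.fst) x) v = _
  rw [this]; simp

theorem dd_zero {X : Type} [NormedAddCommGroup X] [NormedSpace ℂ X] (F : X → ℂ) (x : X) : dd F 0 x = 0 := by
  simp [dd]

theorem ez_fst (i : Fin (n+1)) : (ez i : (Fin (n+1) → ℂ) × (Fin n → ℂ)).1 = eu i := rfl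
theorem ew_fst (i : Fin n) : (ew i : (Fin (n+1) → ℂ) × (Fin n → ℂ)).1 = 0 := rfl

theorem step3a {Θ : (Fin (n+1) → ℂ) × (Fin n → ℂ) → ℂ} {U : Set ((Fin (n+1) → ℂ) × (Fin n → ℂ))} (hU : IsOpen U)
    (hΘ : AnalyticOnNhd ℂ Θ U) (hd : ∀ x ∈ U, (Pm Θ x).det ≠ 0)
    (f : Fin (n+2) → (Fin (n+1) → ℂ) → ℂ) (V : Set (Fin (n+1) → ℂ)) (hV : IsOpen V)
    (hf : ∀ c, AnalyticOnNhd ℂ (f c) V) (κ : ℂ) (hκ : κ ≠ 0) (hW : ∀ z ∈ V, (Wm f z).det = κ)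
    (hUV : ∀ x ∈ U, x.1 ∈ V)
    (G H I : Fin (n+2) → (Fin (n+1) → ℂ) × (Fin n → ℂ) → ℂ)
    (hG : ∀ c, AnalyticOnNhd ℂ (G c) U) (hH : ∀ c, AnalyticOnNhd ℂ (H c) U) (hI : ∀ c, AnalyticOnNhd ℂ (I c) U)
    (hG0 : ∀ x ∈ U, (fun c => G c x) ≠ 0)
    (h0 : ∀ x ∈ U, ∑ c, f c x.1 * G c x = 0)
    (hGz : ∀ c i, ∀ x ∈ U, dd (G c) (ez i) x = H c x * dd Θ (ez i) x)
    (hHz : ∀ c i, ∀ x ∈ U, dd (H c) (ez i) x = I c x * dd Θ (ez i) x) (l i j : Fin (n+1)) :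
    ∀ x ∈ U, Bm f j x.1 i.succ l.succ = Gh Θ l i j x := by
  have hW0 : ∀ z ∈ V, (Wm f z).det ≠ 0 := fun z hz => by rw [hW z hz]; exact hκ
  have hfx : ∀ x ∈ U, ∀ c, AnalyticAt ℂ (f c) x.1 := fun x hx c => hf c _ (hUV x hx)
  have hF : ∀ x ∈ U, ∀ c, AnalyticAt ℂ (fun y : (Fin (n+1) → ℂ) × (Fin n → ℂ) => f c y.1) x :=
    fun x hx c => an_fst (hfx x hx c)
  have hFi : ∀ x ∈ U, ∀ c i, AnalyticAt ℂ (fun y : (Fin (n+1) → ℂ) × (Fin n → ℂ) => dd (f c) (eu i) y.1) x :=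
    fun x hx c i => an_fst (F := dd (f c) (eu i)) (an_dd (hfx x hx c) _)
  let b : (Fin (n+1) → ℂ) × (Fin n → ℂ) → ℂ := fun x => ∑ c, f c x.1 * H c x
  let m : Fin (n+1) → (Fin (n+1) → ℂ) × (Fin n → ℂ) → ℂ := fun i x => ∑ c, dd (f c) (eu i) x.1 * H c x
  let e : (Fin (n+1) → ℂ) × (Fin n → ℂ) → ℂ := fun x => ∑ c, f c x.1 * I c x
  have hb : AnalyticOnNhd ℂ b U := fun x hx => an_sum _ fun c _ => (hF x hx c).fun_mul (hH c x hx)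
  have hm : ∀ i, AnalyticOnNhd ℂ (m i) U := fun i x hx => an_sum _ fun c _ => (hFi x hx c i).fun_mul (hH c x hx)
  have he : AnalyticOnNhd ℂ e U := fun x hx => an_sum _ fun c _ => (hF x hx c).fun_mul (hI c x hx)
  have h1 : ∀ i, ∀ x ∈ U, (∑ c, dd (f c) (eu i) x.1 * G c x) + b x * dd Θ (ez i) x = 0 := by
    intro i x hx
    have h := dd_congrOn hU h0 (ez i) x hx
    rw [dd_const, dd_sum _ (fun c _ => (hF x hx c).fun_mul (hG c x hx))] at h
    simp only [dd_mul (hF x hx _) (hG _ x hx), dd_fst (hfx x hx _), hGz _ _ x hx, ez_fst] at h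
    rw [← h, Finset.sum_add_distrib, Finset.sum_mul]
    congr 1
    exact Finset.sum_congr rfl fun _ _ => by ring
  have hbne : ∀ x ∈ U, b x ≠ 0 := by
    intro x hx hbx
    apply hG0 x hx
    have hWG : (Wm f x.1).mulVec (fun c => G c x) = 0 := by
      ext a
      refine Fin.cases ?_ (fun i => ?_) a
      · exact h0 x hx
      · have := h1 i x hx
        rw [hbx, zero_mul, add_zero] at this
        exact this
    by_contra hne
    exact hW0 _ (hUV x hx) (Matrix.exists_mulVec_eq_zero_iff.1 ⟨_, hne, hWG⟩)
  have hbz : ∀ j, ∀ x ∈ U, dd b (ez j) x = m j x + e x * dd Θ (ez j) x := by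
    intro j x hx
    change dd (fun x => ∑ c, f c x.1 * H c x) (ez j) x = _
    rw [dd_sum _ (fun c _ => (hF x hx c).fun_mul (hH c x hx))]
    simp only [dd_mul (hF x hx _) (hH _ x hx), dd_fst (hfx x hx _), hHz _ _ x hx, ez_fst]
    rw [Finset.sum_add_distrib, Finset.sum_mul]
    congr 1
    exact Finset.sum_congr rfl fun _ _ => by ring
  have hff : ∀ i j, ∀ x ∈ U, ∑ c, dd (dd (f c) (eu i)) (eu j) x.1 * G c x
      = - (b x * ∑ k, Bm f j x.1 i.succ k.succ * dd Θ (ez k) x) := by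
    intro i j x hx
    have h5 : ∀ c, dd (dd (f c) (eu i)) (eu j) x.1 = ∑ a, Bm f j x.1 i.succ a * Wm f x.1 a c := fun c =>
      congrFun (congrFun (dW_eq (hW0 _ (hUV x hx)) j) i.succ) c
    have h6 : ∀ k, ∑ c, dd (f c) (eu k) x.1 * G c x = - (b x * dd Θ (ez k) x) := fun k =>
      eq_neg_of_add_eq_zero_left (h1 k x hx)
    calc ∑ c, dd (dd (f c) (eu i)) (eu j) x.1 * G c x
        = ∑ a, Bm f j x.1 i.succ a * ∑ c, Wm f x.1 a c * G c x := by
          simp only [h5, Finset.sum_mul, Finset.mul_sum]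
          rw [Finset.sum_comm]
          exact Finset.sum_congr rfl fun _ _ => Finset.sum_congr rfl fun _ _ => by ring
      _ = _ := by
          rw [Fin.sum_univ_succ]
          simp only [Wm_zero, Wm_succ, h0 x hx, h6, mul_zero, zero_add, Finset.mul_sum, ← Finset.sum_neg_distrib]
          exact Finset.sum_congr rfl fun _ _ => by ring
  have h2 : ∀ i j, ∀ x ∈ U, b x * dd (dd Θ (ez i)) (ez j) x + m i x * dd Θ (ez j) x + m j x * dd Θ (ez i) x
      + e x * dd Θ (ez i) x * dd Θ (ez j) x = b x * ∑ k, Bm f j x.1 i.succ k.succ * dd Θ (ez k) x := by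
    intro i j x hx
    have h := dd_congrOn hU (h1 i) (ez j) x hx
    have hz := an_dd (hΘ x hx) (ez i)
    rw [dd_const, dd_add (an_sum _ fun c _ => (hFi x hx c i).fun_mul (hG c x hx)) ((hb x hx).fun_mul hz),
      dd_mul (hb x hx) hz, hbz j x hx, dd_sum _ (fun c _ => (hFi x hx c i).fun_mul (hG c x hx))] at h
    simp only [dd_mul (hFi x hx _ i) (hG _ x hx), hGz _ _ x hx] at h
    have h7 : ∀ c, dd (fun y : (Fin (n+1) → ℂ) × (Fin n → ℂ) => dd (f c) (eu i) y.1) (ez j) x = dd (dd (f c) (eu i)) (eu j) x.1 :=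
      fun c => dd_fst (F := dd (f c) (eu i)) (an_dd (hfx x hx c) _) (ez j)
    simp only [h7, Finset.sum_add_distrib] at h
    rw [hff i j x hx] at h
    have h8 : ∑ c, dd (f c) (eu i) x.1 * (H c x * dd Θ (ez j) x) = m i x * dd Θ (ez j) x := by
      rw [Finset.sum_mul]; exact Finset.sum_congr rfl fun _ _ => by ring
    rw [h8] at h
    linear_combination h
  refine gamma_eq hU hΘ hd (fun i x => (m i x + 2⁻¹ * e x * dd Θ (ez i) x) * (b x)⁻¹) ?_
    (fun l i j x => Bm f j x.1 i.succ l.succ) ?_ ?_ ?_ ?_ l i j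
  · intro i x hx
    exact ((hm i x hx).fun_add ((analyticAt_const.fun_mul (he x hx)).fun_mul (an_dd (hΘ x hx) _))).fun_mul ((hb x hx).fun_inv (hbne x hx))
  · intro l i j x hx
    exact an_fst (F := fun z => Bm f j z i.succ l.succ) (an_B (hfx x hx) (hW0 _ (hUV x hx)) _ _ _)
  · intro l i j α x hx
    rw [dd_fst (F := fun z => Bm f j z i.succ l.succ) (an_B (hfx x hx) (hW0 _ (hUV x hx)) _ _ _), ew_fst, dd_zero]
  · intro j x hx
    exact Bm_trace hV hf κ hκ hW j _ (hUV x hx)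
  · intro i j x hx
    have := h2 i j x hx
    have hbx := hbne x hx
    field_simp
    linear_combination 2 * this

/-- linear system built from a connection -/
noncomputable def sysA (B : Fin (n+1) → (Fin (n+1) → ℂ) → Fin (n+2) → Fin (n+2) → ℂ) (z : Fin (n+1) → ℂ) :
    (Fin (n+2) → ℂ) →L[ℂ] (Fin (n+1) → ℂ) →L[ℂ] (Fin (n+2) → ℂ) :=
  ∑ j, ∑ a, ∑ b, B j z a b • (ContinuousLinearMap.proj (R := ℂ) (φ := fun _ : Fin (n+2) => ℂ) b).smulRight
    ((ContinuousLinearMap.proj (R := ℂ) (φ := fun _ : Fin (n+1) => ℂ) j).smulRight (Pi.single a (1:ℂ) : Fin (n+2) → ℂ))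

theorem sysA_apply (B : Fin (n+1) → (Fin (n+1) → ℂ) → Fin (n+2) → Fin (n+2) → ℂ) (z Y j a) :
    sysA B z Y (eu j) a = ∑ b, B j z a b * Y b := by
  simp only [sysA, eu, sum_apply, smul_apply, ContinuousLinearMap.smulRight_apply, ContinuousLinearMap.proj_apply,
    Finset.sum_apply, Pi.smul_apply, smul_eq_mul]
  rw [Finset.sum_eq_single j, Finset.sum_eq_single a]
  · simp
  · intro a' _ ha; simp [Pi.single_apply, ha.symm]
  · simp
  · intro j' _ hj; simp [Pi.single_apply, hj]
  · simp

theorem an_sysA {B : Fin (n+1) → (Fin (n+1) → ℂ) → Fin (n+2) → Fin (n+2) → ℂ} {z} (hB : ∀ j a b, AnalyticAt ℂ (fun y => B j y a b) z) :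
    AnalyticAt ℂ (sysA B) z := by
  unfold sysA
  refine Finset.analyticAt_fun_sum _ fun j _ => Finset.analyticAt_fun_sum _ fun a _ => Finset.analyticAt_fun_sum _ fun b _ => ?_
  exact ((ContinuousLinearMap.toSpanSingleton ℂ _).analyticAt _).comp (hB j a b)

theorem eq_of_eu {L L' : (Fin (n+1) → ℂ) →L[ℂ] (Fin (n+2) → ℂ)} (h : ∀ j a, L (eu j) a = L' (eu j) a) : L = L' := by
  ext v a
  rw [vec_sum v, map_sum, map_sum]
  simp only [map_smul, Finset.sum_apply, Pi.smul_apply]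
  exact Finset.sum_congr rfl fun j _ => congrArg _ (h j a)

theorem core (hn : 1 ≤ n) (Θ : (Fin (n+1) → ℂ) × (Fin n → ℂ) → ℂ) (z0 : Fin (n+1) → ℂ) (w0 : Fin n → ℂ)
    (hΘ : AnalyticAt ℂ Θ (z0, w0)) (hd : (Pm Θ (z0, w0)).det ≠ 0) :
    ∃ δ > 0, (∀ z ∈ ball z0 δ, ∀ w ∈ ball w0 δ, AnalyticAt ℂ Θ (z, w)) ∧ ∀ z1 ∈ ball z0 δ, ∀ w1 ∈ ball w0 δ, ∀ f : Fin (n+2) → (Fin (n+1) → ℂ) → ℂ, ∀ κ : ℂ,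
      ∀ G H I : Fin (n+2) → (Fin (n+1) → ℂ) × (Fin n → ℂ) → ℂ,
      (∀ c, AnalyticAt ℂ (f c) z1) → κ ≠ 0 → (∀ᶠ z in 𝓝 z1, (Wm f z).det = κ) →
      (∀ c, AnalyticAt ℂ (G c) (z1, w1)) → (∀ c, AnalyticAt ℂ (H c) (z1, w1)) → (∀ c, AnalyticAt ℂ (I c) (z1, w1)) →
      (fun c => G c (z1, w1)) ≠ 0 →
      (∀ᶠ x in 𝓝 (z1, w1), ∑ c, f c x.1 * G c x = 0) →
      (∀ c i, ∀ᶠ x in 𝓝 (z1, w1), dd (G c) (ez i) x = H c x * dd Θ (ez i) x) →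
      (∀ c i, ∀ᶠ x in 𝓝 (z1, w1), dd (H c) (ez i) x = I c x * dd Θ (ez i) x) →
      ∃ f' : Fin (n+2) → (Fin (n+1) → ℂ) → ℂ, (∀ c, AnalyticOnNhd ℂ (f' c) (ball z0 δ)) ∧ ∀ c, f' c =ᶠ[𝓝 z1] f c := by
  have hgood : ∀ᶠ x in 𝓝 (z0, w0), AnalyticAt ℂ Θ x ∧ (Pm Θ x).det ≠ 0 :=
    hΘ.eventually_analyticAt.and ((an_det (fun i j => an_Pm hΘ i j)).continuousAt.eventually_ne hd)
  obtain ⟨ε, hε, hball⟩ := Metric.eventually_nhds_iff_ball.1 hgood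
  have hgood' : ∀ z ∈ ball z0 ε, ∀ w ∈ ball w0 ε, AnalyticAt ℂ Θ (z, w) ∧ (Pm Θ (z, w)).det ≠ 0 := by
    intro z hz w hw
    apply hball
    rw [← ball_prod_same]; exact ⟨hz, hw⟩
  -- choice of another index
  have hex : ∀ j : Fin (n+1), ∃ l, l ≠ j := by
    intro j
    have : Nontrivial (Fin (n+1)) := Fin.nontrivial_iff_two_le.2 (by omega)
    exact exists_ne j
  choose o ho using hex
  let Γp : Fin (n+1) → Fin (n+1) → Fin (n+1) → (Fin (n+1) → ℂ) → ℂ := fun l i j z => Gh Θ l i j (z, w0)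
  have hΓp : ∀ l i j, ∀ z ∈ ball z0 ε, AnalyticAt ℂ (Γp l i j) z := by
    intro l i j z hz
    have h := hgood' z hz w0 (mem_ball_self hε)
    exact (an_Gh h.1 h.2 l i j).fun_comp_of_eq (f := fun z => (z, w0)) (analyticAt_id.prod analyticAt_const) rfl
  obtain ⟨δ1, hδ1, hext⟩ := ext_pde (sysA (Bh Γp o)) z0
    (an_sysA fun j a b => an_Bh (fun l i j => hΓp l i j z0 (mem_ball_self hε)) o j a b)
  refine ⟨min δ1 ε, lt_min hδ1 hε, fun z hz w hw => (hgood' z (ball_subset_ball (min_le_right _ _) hz) w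
    (ball_subset_ball (min_le_right _ _) hw)).1, ?_⟩
  intro z1 hz1 w1 hw1 f κ G H I hf hκ hW hG hH hI hG0 h0 hGz hHz
  have hz1ε := ball_subset_ball (min_le_right _ _) hz1
  have hw1ε := ball_subset_ball (min_le_right _ _) hw1
  -- open set V
  have hVe : ∀ᶠ z in 𝓝 z1, (∀ c, AnalyticAt ℂ (f c) z) ∧ (Wm f z).det = κ ∧ z ∈ ball z0 ε :=
    (eventually_all.2 fun c => (hf c).eventually_analyticAt).and (hW.and (isOpen_ball.mem_nhds hz1ε))
  obtain ⟨V, hVs, hVo, hz1V⟩ := _root_.eventually_nhds_iff.1 hVe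
  have hUe : ∀ᶠ x in 𝓝 (z1, w1), (AnalyticAt ℂ Θ x ∧ (Pm Θ x).det ≠ 0) ∧ x.1 ∈ V ∧ (∀ c, AnalyticAt ℂ (G c) x) ∧
      (∀ c, AnalyticAt ℂ (H c) x) ∧ (∀ c, AnalyticAt ℂ (I c) x) ∧ (fun c => G c x) ≠ 0 ∧ ∑ c, f c x.1 * G c x = 0 ∧
      (∀ c i, dd (G c) (ez i) x = H c x * dd Θ (ez i) x) ∧ (∀ c i, dd (H c) (ez i) x = I c x * dd Θ (ez i) x) := by
    have hg := hgood' z1 hz1ε w1 hw1ε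
    refine (hg.1.eventually_analyticAt.and ((an_det (fun i j => an_Pm hg.1 i j)).continuousAt.eventually_ne hg.2)).and ?_
    refine (continuousAt_fst.eventually (hVo.mem_nhds hz1V)).and ?_
    refine (eventually_all.2 fun c => (hG c).eventually_analyticAt).and ?_
    refine (eventually_all.2 fun c => (hH c).eventually_analyticAt).and ?_
    refine (eventually_all.2 fun c => (hI c).eventually_analyticAt).and ?_
    refine ((continuousAt_pi.2 fun c => (hG c).continuousAt).eventually_ne hG0).and ?_
    refine h0.and ?_
    exact (eventually_all.2 fun c => eventually_all.2 fun i => hGz c i).and (eventually_all.2 fun c => eventually_all.2 fun i => hHz c i)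
  obtain ⟨U, hUs, hUo, hx1U⟩ := _root_.eventually_nhds_iff.1 hUe
  have h3 := fun l i j => step3a hUo (fun x hx => (hUs x hx).1.1) (fun x hx => (hUs x hx).1.2) f V hVo
    (fun c z hz => (hVs z hz).1 c) κ hκ (fun z hz => (hVs z hz).2.1) (fun x hx => (hUs x hx).2.1) G H I
    (fun c x hx => (hUs x hx).2.2.1 c) (fun c x hx => (hUs x hx).2.2.2.1 c) (fun c x hx => (hUs x hx).2.2.2.2.1 c)
    (fun x hx => (hUs x hx).2.2.2.2.2.1) (fun x hx => (hUs x hx).2.2.2.2.2.2.1) (fun c i x hx => (hUs x hx).2.2.2.2.2.2.2.1 c i)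
    (fun c i x hx => (hUs x hx).2.2.2.2.2.2.2.2 c i) l i j
  have h4 : ∀ᶠ z in 𝓝 z1, z ∈ V ∧ ∀ l i j, Bm f j z i.succ l.succ = Γp l i j z := by
    have hU' : ∀ᶠ z in 𝓝 z1, (z, w1) ∈ U :=
      (Continuous.prodMk_left w1).continuousAt.eventually (hUo.mem_nhds hx1U)
    filter_upwards [hU', hVo.mem_nhds hz1V] with z hzU hzV
    refine ⟨hzV, fun l i j => ?_⟩
    have hzε := (hVs z hzV).2.2
    have han : AnalyticOnNhd ℂ (fun w => Gh Θ l i j (z, w)) (ball w0 ε) := by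
      intro w hw
      have h := hgood' z hzε w hw
      exact (an_Gh h.1 h.2 l i j).fun_comp_of_eq (f := fun w => (z, w)) (analyticAt_const.prod analyticAt_id) rfl
    have hev : (fun w => Gh Θ l i j (z, w)) =ᶠ[𝓝 w1] (fun _ => Bm f j z i.succ l.succ) := by
      have : ∀ᶠ w in 𝓝 w1, (z, w) ∈ U := (Continuous.prodMk_right z).continuousAt.eventually (hUo.mem_nhds hzU)
      filter_upwards [this] with w hw
      exact (h3 l i j (z, w) hw).symm
    exact (han.eqOn_of_preconnected_of_eventuallyEq analyticOnNhd_const (convex_ball w0 ε).isPreconnected hw1ε hev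
      (mem_ball_self hε)).symm
  obtain ⟨V', hV's, hV'o, hz1V'⟩ := _root_.eventually_nhds_iff.1 h4
  have hdet : ∀ z ∈ V', (Wm f z).det ≠ 0 := fun z hz => by rw [(hVs z (hV's z hz).1).2.1]; exact hκ
  have hfV' : ∀ c, AnalyticOnNhd ℂ (f c) V' := fun c z hz => (hVs z (hV's z hz).1).1 c
  have h5 : ∀ j a b, ∀ z ∈ V', Bm f j z a b = Bh Γp o j z a b := fun j a b =>
    Bm_eq_Bh hV'o hfV' hdet o ho Γp (fun l i j z hz => (hV's z hz).2 l i j) j a b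
  have h6 : ∀ c, ∃ Y' : (Fin (n+1) → ℂ) → (Fin (n+2) → ℂ), AnalyticOnNhd ℂ Y' (ball z0 δ1) ∧ Y' =ᶠ[𝓝 z1] (fun z a => Wm f z a c) := by
    intro c
    have hYan : ∀ z ∈ V', AnalyticAt ℂ (fun z a => Wm f z a c) z := fun z hz =>
      AnalyticAt.pi fun a => an_W (fun c => hfV' c z hz) a c
    refine hext z1 (ball_subset_ball (min_le_left _ _) hz1) _ (hYan z1 hz1V') ?_
    filter_upwards [hV'o.mem_nhds hz1V'] with z hz
    refine eq_of_eu fun j a => ?_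
    rw [sysA_apply]
    have h7 := congrFun (congrFun (dW_eq (hdet z hz) j) a) c
    rw [Matrix.mul_apply] at h7
    simp only [← h5 j a _ z hz]
    rw [← h7, fderiv_pi (fun a => (an_W (fun c => hfV' c z hz) a c).differentiableAt)]
    rfl
  choose Y' hY'a hY'e using h6
  refine ⟨fun c z => Y' c z 0, fun c z hz => ?_, fun c => ?_⟩
  · exact analyticAt_pi_iff.1 (hY'a c z (ball_subset_ball (min_le_left _ _) hz)) 0
  · filter_upwards [hY'e c] with z hz
    rw [hz]; rfl

end
end Sph
end

section
open Topology Filter Metric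

namespace Sph
section conj

/-- conjugate of a multilinear map -/
noncomputable def conjM {N k : ℕ} (m : (Fin N → ℂ) [×k]→L[ℂ] ℂ) : (Fin N → ℂ) [×k]→L[ℂ] ℂ :=
  MultilinearMap.mkContinuous
    { toFun := fun v => star (m (fun i => star (v i)))
      map_update_add' := by
        intro hd v i x y
        have h : ∀ u : Fin N → ℂ, (fun j => star (Function.update v i u j)) = Function.update (fun j => star (v j)) i (star u) := by
          intro u; ext1 j
          by_cases hj : j = i
          · subst hj; simp
          · simp [hj]
        rw [h, h, h, star_add]
        have := m.map_update_add (fun j => star (v j)) i (star x) (star y)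
        simp at this ⊢
      map_update_smul' := by
        intro hd v i c x
        have h : ∀ u : Fin N → ℂ, (fun j => star (Function.update v i u j)) = Function.update (fun j => star (v j)) i (star u) := by
          intro u; ext1 j
          by_cases hj : j = i
          · subst hj; simp
          · simp [hj]
        rw [h, h, star_smul]
        have := m.map_update_smul (fun j => star (v j)) i (star c) (star x)
        simp at this ⊢ } ‖m‖ (by
    intro v
    simp only [MultilinearMap.coe_mk, norm_star]
    have := m.le_opNorm (fun i => star (v i))
    simpa [norm_star] using this)

theorem conjM_apply {N k : ℕ} (m : (Fin N → ℂ) [×k]→L[ℂ] ℂ) (v) : conjM m v = star (m (fun i => star (v i))) := rfl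

theorem conjM_norm {N k : ℕ} (m : (Fin N → ℂ) [×k]→L[ℂ] ℂ) : ‖conjM m‖ ≤ ‖m‖ :=
  MultilinearMap.mkContinuous_norm_le _ (norm_nonneg _) _

theorem an_conj {N : ℕ} {f : (Fin N → ℂ) → ℂ} {z : Fin N → ℂ} (hf : AnalyticAt ℂ f z) :
    AnalyticAt ℂ (fun w => star (f (star w))) (star z) := by
  obtain ⟨p, r, hp⟩ := hf
  refine ⟨fun k => conjM (p k), r, ?_, hp.r_pos, ?_⟩
  · exact hp.r_le.trans (FormalMultilinearSeries.radius_le_of_le (fun k => conjM_norm (p k)))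
  · intro y hy
    have hy' : star y ∈ Metric.eball (0 : Fin N → ℂ) r := by
      simpa [Metric.mem_eball, edist_zero_right, enorm_eq_nnnorm] using hy
    have := (hp.hasSum hy').star
    simpa [conjM_apply, star_add] using this

end conj

section form
variable {n : ℕ}

/-- signs -/
noncomputable def eps (e : ℕ) (α : Fin n) : ℂ := if (α : ℕ) < e then 1 else -1

/-- matrix of the form applied to a vector -/
noncomputable def Jv (e : ℕ) (b : Fin (n+2) → ℂ) (c : Fin (n+2)) : ℂ :=
  Fin.cases (motive := fun _ => ℂ) (- b (Fin.last (n+1)))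
    (fun j => Fin.lastCases (motive := fun _ => ℂ) (b 0) (fun α => (-2 * Complex.I * eps e α) * b α.castSucc.succ) j) c

/-- the bilinear form -/
noncomputable def hf (e : ℕ) (a b : Fin (n+2) → ℂ) : ℂ := ∑ c, a c * Jv e b c

theorem hf_expand (e : ℕ) (a b : Fin (n+2) → ℂ) : hf e a b = a (Fin.last (n+1)) * b 0 - a 0 * b (Fin.last (n+1))
    - 2 * Complex.I * ∑ α : Fin n, eps e α * a α.castSucc.succ * b α.castSucc.succ := by
  rw [hf, Fin.sum_univ_succ, Fin.sum_univ_castSucc]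
  simp only [Jv, Fin.cases_zero, Fin.cases_succ, Fin.lastCases_last, Fin.lastCases_castSucc, Finset.mul_sum]
  rw [Fin.succ_last, sub_eq_add_neg (_ - _), ← Finset.sum_neg_distrib]
  have : ∑ x : Fin n, a x.castSucc.succ * (-2 * Complex.I * eps e x * b x.castSucc.succ)
    = ∑ x : Fin n, -(2 * Complex.I * (eps e x * a x.castSucc.succ * b x.castSucc.succ)) :=
    Finset.sum_congr rfl fun _ _ => by ring
  rw [this]; ring

theorem eps_ne (e : ℕ) (α : Fin n) : eps e α ≠ 0 := by unfold eps; split_ifs <;> simp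

theorem Jv_inj (e : ℕ) (b : Fin (n+2) → ℂ) (h : Jv e b = 0) : b = 0 := by
  ext c
  refine Fin.cases ?_ (fun j => ?_) c
  · have := congrFun h (Fin.last n).succ
    simpa only [Jv, Fin.cases_succ, Fin.lastCases_last, Pi.zero_apply] using this
  · refine Fin.lastCases ?_ (fun α => ?_) j
    · have := congrFun h 0
      simpa [Jv] using this
    · have := congrFun h α.castSucc.succ
      simpa [Jv, eps_ne] using this

theorem an_Jv {X : Type} [NormedAddCommGroup X] [NormedSpace ℂ X] (e : ℕ) {b : Fin (n+2) → X → ℂ} {x : X}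
    (hb : ∀ c, AnalyticAt ℂ (b c) x) (c) : AnalyticAt ℂ (fun y => Jv e (fun c => b c y) c) x := by
  refine Fin.cases ?_ (fun j => ?_) c
  · simp only [Jv, Fin.cases_zero]; exact (hb _).fun_neg
  · refine Fin.lastCases ?_ (fun α => ?_) j
    · simp only [Jv, Fin.cases_succ, Fin.lastCases_last]; exact hb _
    · simp only [Jv, Fin.cases_succ, Fin.lastCases_castSucc]; exact analyticAt_const.fun_mul (hb _)

/-- a local normalized frame -/
def Good (e : ℕ) (M : Set (Fin (n+1) → ℂ)) (q : Fin (n+1) → ℂ) (f : Fin (n+2) → (Fin (n+1) → ℂ) → ℂ) : Prop :=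
  (∀ c, AnalyticAt ℂ (f c) q) ∧ (∃ κ : ℂ, κ ≠ 0 ∧ ∀ᶠ z in 𝓝 q, (Wm f z).det = κ) ∧
    ∀ᶠ z in 𝓝 q, z ∈ M → hf e (fun c => f c z) (fun c => star (f c z)) = 0

theorem Good.congr {e : ℕ} {M : Set (Fin (n+1) → ℂ)} {q : Fin (n+1) → ℂ} {f f' : Fin (n+2) → (Fin (n+1) → ℂ) → ℂ}
    (h : Good e M q f) (hff : ∀ c, f' c =ᶠ[𝓝 q] f c) : Good e M q f' := by
  obtain ⟨h1, ⟨κ, hκ, h2⟩, h3⟩ := h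
  have hall : ∀ᶠ z in 𝓝 q, ∀ c, f' c =ᶠ[𝓝 z] f c := eventually_all.2 fun c => (hff c).eventually_nhds
  refine ⟨fun c => (h1 c).congr (hff c).symm, ⟨κ, hκ, ?_⟩, ?_⟩
  · filter_upwards [h2, hall] with z hz hz2
    have : Wm f' z = Wm f z := by
      ext a c
      refine Fin.cases ?_ (fun i => ?_) a
      · exact (hz2 c).eq_of_nhds
      · exact dd_congr (hz2 c) _
    rw [this, hz]
  · filter_upwards [h3, hall] with z hz hz2 hzM
    have : ∀ c, f' c z = f c z := fun c => (hz2 c).eq_of_nhds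
    simp only [this]
    exact hz hzM

end form

section zeta
variable {n : ℕ}

/-- the solved point -/
noncomputable def zet (j0 : Fin (n+1)) (Θ : (Fin (n+1) → ℂ) × (Fin n → ℂ) → ℂ) (x : (Fin (n+1) → ℂ) × (Fin n → ℂ)) : Fin (n+1) → ℂ :=
  ins j0 (Θ x, x.2)

theorem an_zet {j0 : Fin (n+1)} {Θ : (Fin (n+1) → ℂ) × (Fin n → ℂ) → ℂ} {x} (hΘ : AnalyticAt ℂ Θ x) :
    AnalyticAt ℂ (zet j0 Θ) x :=
  ((ins j0).analyticAt _).comp (hΘ.prod analyticAt_snd)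

theorem dd_zet {j0 : Fin (n+1)} {Θ : (Fin (n+1) → ℂ) × (Fin n → ℂ) → ℂ} {x} (hΘ : AnalyticAt ℂ Θ x)
    {k : (Fin (n+1) → ℂ) → ℂ} (hk : AnalyticAt ℂ k (zet j0 Θ x)) (i : Fin (n+1)) :
    dd (fun y => k (zet j0 Θ y)) (ez i) x = dd k (eu j0) (zet j0 Θ x) * dd Θ (ez i) x := by
  have hz : HasFDerivAt (zet j0 Θ) ((ins j0).comp ((fderiv ℂ Θ x).prod (ContinuousLinearMap.snd ℂ _ _))) x :=
    (ins j0).hasFDerivAt.comp x (hΘ.differentiableAt.hasFDerivAt.prodMk hasFDerivAt_snd)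
  have := (hk.differentiableAt.hasFDerivAt.comp x hz).fderiv
  unfold dd
  change (fderiv ℂ (k ∘ zet j0 Θ) x) (ez i) = _
  rw [this]
  simp only [ContinuousLinearMap.comp_apply, ContinuousLinearMap.prod_apply, ContinuousLinearMap.coe_snd']
  change (fderiv ℂ k (zet j0 Θ x)) (ins j0 (_, 0)) = _
  rw [ins_s0, map_smul, smul_eq_mul, mul_comm]; rfl

theorem zet_sharp {j0 : Fin (n+1)} {Θ : (Fin (n+1) → ℂ) × (Fin n → ℂ) → ℂ} {z} (h : star (z j0) = Θ (sharp j0 z)) :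
    zet j0 Θ (sharp j0 z) = star z := by
  rw [zet, ← h, sharp_apply]
  exact ins_rem j0 (star z)

/-- conjugate functions -/
noncomputable def gJ (e : ℕ) (f : Fin (n+2) → (Fin (n+1) → ℂ) → ℂ) (c : Fin (n+2)) (w : Fin (n+1) → ℂ) : ℂ :=
  Jv e (fun c => star (f c (star w))) c

theorem an_gJ {e : ℕ} {f : Fin (n+2) → (Fin (n+1) → ℂ) → ℂ} {w} (h : ∀ c, AnalyticAt ℂ (f c) (star w)) (c) :
    AnalyticAt ℂ (gJ e f c) w :=
  an_Jv e (b := fun c w => star (f c (star w))) (fun c => by simpa using an_conj (h c)) c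

/-- complexified equation -/
noncomputable def Kf (e : ℕ) (f : Fin (n+2) → (Fin (n+1) → ℂ) → ℂ) (j0 : Fin (n+1)) (Θ : (Fin (n+1) → ℂ) × (Fin n → ℂ) → ℂ)
    (x : (Fin (n+1) → ℂ) × (Fin n → ℂ)) : ℂ := ∑ c, f c x.1 * gJ e f c (zet j0 Θ x)

theorem an_Kf {e : ℕ} {f : Fin (n+2) → (Fin (n+1) → ℂ) → ℂ} {j0 : Fin (n+1)} {Θ : (Fin (n+1) → ℂ) × (Fin n → ℂ) → ℂ} {x}
    (hΘ : AnalyticAt ℂ Θ x) (h1 : ∀ c, AnalyticAt ℂ (f c) x.1) (h2 : ∀ c, AnalyticAt ℂ (f c) (star (zet j0 Θ x))) :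
    AnalyticAt ℂ (Kf e f j0 Θ) x :=
  an_sum _ fun c _ => (an_fst (h1 c)).fun_mul ((an_gJ h2 c).fun_comp_of_eq (an_zet hΘ) rfl)

theorem Kf_sharp {e : ℕ} {f : Fin (n+2) → (Fin (n+1) → ℂ) → ℂ} {j0 : Fin (n+1)} {Θ : (Fin (n+1) → ℂ) × (Fin n → ℂ) → ℂ} {z}
    (h : star (z j0) = Θ (sharp j0 z)) : Kf e f j0 Θ (sharp j0 z) = hf e (fun c => f c z) (fun c => star (f c z)) := by
  unfold Kf gJ
  rw [zet_sharp h, star_star, sharp_apply]; rfl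

theorem Kzero {e : ℕ} {M : Set (Fin (n+1) → ℂ)} {q : Fin (n+1) → ℂ} {f : Fin (n+2) → (Fin (n+1) → ℂ) → ℂ}
    (hg : Good e M q f) (j0 : Fin (n+1)) (Θ : (Fin (n+1) → ℂ) × (Fin n → ℂ) → ℂ) (r : (Fin (n+1) → ℂ) → ℝ)
    (hΘ : AnalyticAt ℂ Θ (sharp j0 q)) (hr : AnalyticAt ℝ r q) (hq : r q = 0)
    (hd : fderiv ℝ r q (Pi.single j0 1) ≠ 0 ∨ fderiv ℝ r q (Pi.single j0 Complex.I) ≠ 0)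
    (hM : ∀ᶠ z in 𝓝 q, r z = 0 → z ∈ M) (hiff : ∀ᶠ z in 𝓝 q, (r z = 0 ↔ star (z j0) = Θ (sharp j0 z))) :
    ∀ᶠ x in 𝓝 (sharp j0 q), Kf e f j0 Θ x = 0 := by
  have hq' := hiff.self_of_nhds.1 hq
  refine tot_real j0 r q hr hq hd ℂ _ (an_Kf hΘ ?_ ?_) ?_
  · rw [sharp_apply]; exact hg.1
  · rw [zet_sharp hq', star_star]; exact hg.1
  · filter_upwards [hM, hiff, hg.2.2] with y h1 h2 h3 hy
    rw [Kf_sharp (h2.1 hy)]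
    exact h3 (h1 hy)

end zeta
end Sph
end

section
open Topology Filter Metric

namespace Sph
section
variable {n : ℕ}

theorem det_Pm_ne {Θ : (Fin (n+1) → ℂ) × (Fin n → ℂ) → ℂ} {x} (hΘ : AnalyticAt ℂ Θ x)
    (h : ∀ v : Fin (n+1) → ℂ, fderiv ℂ Θ x (v, 0) = 0 →
        (∀ u : Fin n → ℂ, fderiv ℂ (fun x => fderiv ℂ Θ x (v, 0)) x (0, u) = 0) → v = 0) : (Pm Θ x).det ≠ 0 := by
  intro hdet
  obtain ⟨v, hv, hPv⟩ := Matrix.exists_mulVec_eq_zero_iff.2 hdet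
  apply hv
  have hsum : ∀ y, fderiv ℂ Θ y (v, 0) = ∑ k, dd Θ (ez k) y * v k := by
    intro y
    rw [D_sum1]
    exact Finset.sum_congr rfl fun k _ => by rw [smul_eq_mul, mul_comm]; rfl
  refine h v ?_ fun u => ?_
  · rw [hsum]; exact congrFun hPv 0
  · simp only [hsum]
    rw [D_sum2]
    refine Finset.sum_eq_zero fun α _ => ?_
    have h1 : dd (fun y => ∑ k, dd Θ (ez k) y * v k) (ew α) x = 0 := by
      rw [dd_sum _ (fun k _ => (an_dd hΘ _).fun_mul analyticAt_const)]
      have hc : ∀ c : ℂ, AnalyticAt ℂ (fun _ : (Fin (n+1) → ℂ) × (Fin n → ℂ) => c) x := fun c => analyticAt_const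
      simp only [dd_mul (an_dd hΘ _) (hc _), dd_const, mul_zero, add_zero]
      exact congrFun hPv α.succ
    have h2 : (fderiv ℂ (fun y => ∑ k, dd Θ (ez k) y * v k) x) (0, Pi.single α 1) = 0 := h1
    rw [h2, smul_zero]

theorem star_ball {N : ℕ} {z p : Fin N → ℂ} {δ : ℝ} (h : z ∈ ball (star p) δ) : star z ∈ ball p δ := by
  rw [mem_ball, dist_eq_norm] at h ⊢
  rw [← norm_star, star_sub, star_star]; exact h

theorem propagate (hn : 1 ≤ n) (M : Set (Fin (n+1) → ℂ)) (hM : IsNondegHypersurface (n+1) M) (p : Fin (n+1) → ℂ) (hp : p ∈ M) :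
    ∃ O : Set (Fin (n+1) → ℂ), IsOpen O ∧ p ∈ O ∧ ∀ q ∈ O, q ∈ M → ∀ e f, Good e M q f → ∃ f', Good e M p f' := by
  obtain ⟨V, r, hVo, hpV, hr, hMV, hdr, hLevi⟩ := hM p hp
  have hMr : ∀ z ∈ V, (z ∈ M ↔ r z = 0) := by
    intro z hz
    have := Set.ext_iff.1 hMV z
    simp only [Set.mem_inter_iff, Set.mem_ofPred_eq] at this
    tauto
  have hrp := (hMr p hpV).1 hp
  obtain ⟨j0, Θ, hΘ, hΘp, hiff, hd, hker⟩ := local_picture n r p (hr p hpV) hrp (hdr p hpV) (hLevi p ⟨hp, hpV⟩)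
  have hdet := det_Pm_ne hΘ hker
  have hsp : sharp j0 p = (p, rem j0 (star p)) := sharp_apply j0 p
  rw [hsp] at hΘ hdet
  obtain ⟨δ, hδ, hΘa, hcore⟩ := core hn Θ p (rem j0 (star p)) hΘ hdet
  have hzp : zet j0 Θ (sharp j0 p) = star p := zet_sharp hΘp.symm
  have hΘx : ∀ x ∈ ball (sharp j0 p) δ, AnalyticAt ℂ Θ x ∧ x.1 ∈ ball p δ ∧ x.2 ∈ ball (rem j0 (star p)) δ := by
    intro x hx
    rw [hsp, ← ball_prod_same] at hx
    exact ⟨hΘa x.1 hx.1 x.2 hx.2, hx⟩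
  have hz : ∀ᶠ x in 𝓝 (sharp j0 p), zet j0 Θ x ∈ ball (star p) δ := by
    have : ContinuousAt (zet j0 Θ) (sharp j0 p) := (an_zet (hΘx _ (mem_ball_self hδ)).1).continuousAt
    exact this.eventually (by rw [hzp]; exact isOpen_ball.mem_nhds (mem_ball_self hδ))
  obtain ⟨η, hη, hηz⟩ := Metric.eventually_nhds_iff_ball.1 (hz.and (isOpen_ball.mem_nhds (mem_ball_self hδ) : ball (sharp j0 p) δ ∈ 𝓝 (sharp j0 p)))
  have hd' : ∀ᶠ z in 𝓝 p, fderiv ℝ r z (Pi.single j0 1) ≠ 0 ∨ fderiv ℝ r z (Pi.single j0 Complex.I) ≠ 0 := by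
    have hcont : ContinuousAt (fderiv ℝ r) p := (hr p hpV).fderiv.continuousAt
    rcases hd with h | h
    · have : ContinuousAt (fun z => fderiv ℝ r z (Pi.single j0 1)) p := hcont.clm_apply continuousAt_const
      exact (this.eventually_ne h).mono fun z hz => Or.inl hz
    · have : ContinuousAt (fun z => fderiv ℝ r z (Pi.single j0 Complex.I)) p := hcont.clm_apply continuousAt_const
      exact (this.eventually_ne h).mono fun z hz => Or.inr hz
  have hsh : ∀ᶠ z in 𝓝 p, sharp j0 z ∈ ball (sharp j0 p) η :=
    (sharp j0).continuous.continuousAt.eventually (isOpen_ball.mem_nhds (mem_ball_self hη))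
  have hVe : ∀ᶠ z in 𝓝 p, z ∈ V := hVo.mem_nhds hpV
  obtain ⟨O, hO, hOo, hpO⟩ := _root_.eventually_nhds_iff.1 (hVe.and (hiff.and (hd'.and hsh)))
  refine ⟨O, hOo, hpO, fun q hqO hqM e f hgood => ?_⟩
  obtain ⟨hqV, hqiff, hqd, hqs⟩ := hO q hqO
  have hrq := (hMr q hqV).1 hqM
  have hΘq := hqiff.1 hrq
  have hx1 := hΘx _ (hηz _ hqs).2
  have hMq : ∀ᶠ z in 𝓝 q, r z = 0 → z ∈ M := by
    filter_upwards [hVo.mem_nhds hqV] with z hz using (hMr z hz).2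
  have hiffq : ∀ᶠ z in 𝓝 q, (r z = 0 ↔ star (z j0) = Θ (sharp j0 z)) := by
    filter_upwards [hOo.mem_nhds hqO] with z hz using (hO z hz).2.1
  have hK : ∀ f, Good e M q f → ∀ᶠ x in 𝓝 (sharp j0 q), Kf e f j0 Θ x = 0 := fun f hf =>
    Kzero hf j0 Θ r hx1.1 (hr q hqV) hrq hqd hMq hiffq
  have hzq : zet j0 Θ (sharp j0 q) = star q := zet_sharp hΘq
  have hsq : sharp j0 q = (q, rem j0 (star q)) := sharp_apply j0 q
  obtain ⟨hfa, ⟨κ, hκ, hW⟩, hfM⟩ := id hgood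
  have hga : ∀ c, AnalyticAt ℂ (gJ e f c) (zet j0 Θ (sharp j0 q)) := fun c =>
    an_gJ (by rw [hzq, star_star]; exact hfa) c
  have hga1 : ∀ c, AnalyticAt ℂ (dd (gJ e f c) (eu j0)) (zet j0 Θ (sharp j0 q)) := fun c => an_dd (hga c) _
  have hga2 : ∀ c, AnalyticAt ℂ (dd (dd (gJ e f c) (eu j0)) (eu j0)) (zet j0 Θ (sharp j0 q)) := fun c => an_dd (hga1 c) _
  have hza := an_zet (j0 := j0) hx1.1
  have hdz : ∀ k : (Fin (n+1) → ℂ) → ℂ, AnalyticAt ℂ k (zet j0 Θ (sharp j0 q)) → ∀ i, ∀ᶠ x in 𝓝 (sharp j0 q),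
      dd (fun y => k (zet j0 Θ y)) (ez i) x = dd k (eu j0) (zet j0 Θ x) * dd Θ (ez i) x := by
    intro k hk i
    filter_upwards [hx1.1.eventually_analyticAt, hza.continuousAt.eventually hk.eventually_analyticAt] with x h1 h2
    exact dd_zet h1 h2 i
  have hcq := hcore q hx1.2.1 (rem j0 (star q)) (by have := hx1.2.2; rw [hsq] at this; exact this) f κ
    (fun c x => gJ e f c (zet j0 Θ x)) (fun c x => dd (gJ e f c) (eu j0) (zet j0 Θ x))
    (fun c x => dd (dd (gJ e f c) (eu j0)) (eu j0) (zet j0 Θ x))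
  rw [← hsq] at hcq
  obtain ⟨f', hf'a, hf'e⟩ := hcq hfa hκ hW (fun c => (hga c).fun_comp_of_eq hza rfl)
    (fun c => (hga1 c).fun_comp_of_eq hza rfl) (fun c => (hga2 c).fun_comp_of_eq hza rfl)
    (by
      intro h
      rw [hzq] at h
      have h1 : Jv e (fun c => star (f c (star (star q)))) = 0 := h
      have h2 := Jv_inj e _ h1
      have h3 : ∀ c, Wm f q 0 c = 0 := by
        intro c
        have := congrFun h2 c
        simpa using this
      exact hκ (by rw [← hW.self_of_nhds]; exact Matrix.det_eq_zero_of_row_eq_zero 0 h3))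
    (hK f hgood) (fun c i => hdz _ (hga c) i) (fun c i => hdz _ (hga1 c) i)
  have hgood' : Good e M q f' := hgood.congr hf'e
  refine ⟨f', fun c => hf'a c p (mem_ball_self hδ), ⟨κ, hκ, ?_⟩, ?_⟩
  · have hda : AnalyticOnNhd ℂ (fun z => (Wm f' z).det) (ball p δ) := fun z hz =>
      an_det fun a c => an_W (fun c => hf'a c z hz) a c
    obtain ⟨-, ⟨κ', hκ', hW'⟩, -⟩ := hgood'
    have hdq : (fun z => (Wm f' z).det) =ᶠ[𝓝 q] fun _ => κ := by
      have hall : ∀ᶠ z in 𝓝 q, ∀ c, f' c =ᶠ[𝓝 z] f c := eventually_all.2 fun c => (hf'e c).eventually_nhds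
      filter_upwards [hW, hall] with z hz hz2
      have : Wm f' z = Wm f z := by
        ext a c
        refine Fin.cases ?_ (fun i => ?_) a
        · exact (hz2 c).eq_of_nhds
        · exact dd_congr (hz2 c) _
      rw [this, hz]
    have := hda.eqOn_of_preconnected_of_eventuallyEq analyticOnNhd_const (convex_ball p δ).isPreconnected (by
      have := hx1.2.1; rw [hsq] at this; exact this) hdq
    filter_upwards [isOpen_ball.mem_nhds (mem_ball_self hδ)] with z hz using this hz
  · have hKa : AnalyticOnNhd ℂ (Kf e f' j0 Θ) (ball (sharp j0 p) η) := by
      intro x hx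
      have h1 := hΘx x (hηz x hx).2
      refine an_Kf h1.1 (fun c => hf'a c _ h1.2.1) (fun c => hf'a c _ (star_ball (hηz x hx).1))
    have hK0 := hKa.eqOn_of_preconnected_of_eventuallyEq (g := fun _ => 0) analyticOnNhd_const
      (convex_ball _ η).isPreconnected hqs (hK f' hgood')
    filter_upwards [hOo.mem_nhds hpO] with z hz hzM
    obtain ⟨h1, h2, h3, h4⟩ := hO z hz
    rw [← Kf_sharp (Θ := Θ) (j0 := j0) (h2.1 ((hMr z h1).1 hzM))]
    exact hK0 h4

end
end Sph
end

section
open Topology Filter Metric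

namespace Sph
section
variable {n : ℕ}

theorem W_scale {g : (Fin (n+1) → ℂ) → ℂ} {f : Fin (n+2) → (Fin (n+1) → ℂ) → ℂ} {z} (hg : AnalyticAt ℂ g z)
    (hf : ∀ c, AnalyticAt ℂ (f c) z) : (Wm (fun c y => g y * f c y) z).det = g z ^ (n+2) * (Wm f z).det := by
  let L : Matrix (Fin (n+2)) (Fin (n+2)) ℂ := Matrix.of fun a b =>
    Fin.cases (motive := fun _ => ℂ) (if b = 0 then g z else 0)
      (fun i => Fin.cases (motive := fun _ => ℂ) (dd g (eu i) z) (fun k => if k = i then g z else 0) b) a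
  have hL : Wm (fun c y => g y * f c y) z = L * Wm f z := by
    ext a c
    rw [Matrix.mul_apply, Fin.sum_univ_succ]
    refine Fin.cases ?_ (fun i => ?_) a
    · simp [L]
    · simp only [Wm_succ, Wm_zero, L, Matrix.of_apply, Fin.cases_succ, Fin.cases_zero]
      rw [dd_mul hg (hf c)]; simp
  have hdet : L.det = g z ^ (n+2) := by
    rw [Matrix.det_of_isLowerTriangular]
    · have : ∀ i, L i i = g z := by
        intro i
        refine Fin.cases ?_ (fun i => ?_) i
        · simp [L]
        · simp [L]
      simp [this]
    · intro a b hab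
      revert hab
      refine Fin.cases ?_ (fun i => ?_) a
      · intro hab
        have : b ≠ 0 := by rintro rfl; exact absurd hab (by simp)
        simp [L, this]
      · refine Fin.cases ?_ (fun k => ?_) b
        · intro hab; exact absurd (OrderDual.toDual_lt_toDual.1 hab) (Fin.not_lt_zero _)
        · intro hab
          have : k ≠ i := by rintro rfl; exact absurd hab (by simp)
          simp [L, this]
  rw [hL, Matrix.det_mul, hdet]

/-- homogenization -/
noncomputable def hom (φ : (Fin (n+1) → ℂ) → (Fin (n+1) → ℂ)) (c : Fin (n+2)) (z : Fin (n+1) → ℂ) : ℂ :=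
  Fin.cases (motive := fun _ => ℂ) 1 (fun j => φ z j) c

@[simp] theorem hom_zero (φ : (Fin (n+1) → ℂ) → (Fin (n+1) → ℂ)) (z) : hom φ 0 z = 1 := rfl
@[simp] theorem hom_succ (φ : (Fin (n+1) → ℂ) → (Fin (n+1) → ℂ)) (j z) : hom φ (Fin.succ j) z = φ z j := rfl

theorem an_hom {φ : (Fin (n+1) → ℂ) → (Fin (n+1) → ℂ)} {z} (h : AnalyticAt ℂ φ z) (c) : AnalyticAt ℂ (hom φ c) z := by
  refine Fin.cases ?_ (fun j => ?_) c
  · exact analyticAt_const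
  · exact analyticAt_pi_iff.1 h j

theorem dd_eu {F : (Fin (n+1) → ℂ) → ℂ} {z} (v : Fin (n+1) → ℂ) : dd F v z = ∑ i, v i * dd F (eu i) z := by
  unfold dd
  conv_lhs => rw [vec_sum v, map_sum]
  simp [eu]

theorem dd_comp {φ : (Fin (n+1) → ℂ) → (Fin (n+1) → ℂ)} {z} (h : AnalyticAt ℂ φ z) (v j) :
    dd (fun y => φ y j) v z = fderiv ℂ φ z v j := by
  have hd : ∀ j, DifferentiableAt ℂ (fun y => φ y j) z := fun j => (analyticAt_pi_iff.1 h j).differentiableAt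
  have := fderiv_pi hd
  unfold dd
  change _ = fderiv ℂ (fun y j => φ y j) z v j
  rw [this]; rfl

theorem hom_vecMul {φ : (Fin (n+1) → ℂ) → (Fin (n+1) → ℂ)} {z} (h : AnalyticAt ℂ φ z) (v : Fin (n+2) → ℂ) :
    Matrix.vecMul v (Wm (hom φ) z) = Fin.cases (motive := fun _ => ℂ) (v 0) (fun j => v 0 * φ z j + fderiv ℂ φ z (fun i => v i.succ) j) := by
  ext c
  rw [Matrix.vecMul, dotProduct, Fin.sum_univ_succ]
  refine Fin.cases ?_ (fun j => ?_) c
  · have : dd (hom φ 0) = fun _ _ => 0 := by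
      ext v z
      change dd (fun _ => 1) v z = 0
      exact dd_const _ _ _
    simp [this]
  · simp only [Wm_zero, Wm_succ, hom_succ, Fin.cases_succ]
    rw [← dd_comp h, dd_eu]; rfl

theorem det_hom_iff {φ : (Fin (n+1) → ℂ) → (Fin (n+1) → ℂ)} {z} (h : AnalyticAt ℂ φ z) :
    (Wm (hom φ) z).det ≠ 0 ↔ Function.Injective (fderiv ℂ φ z) := by
  rw [injective_iff_map_eq_zero]
  constructor
  · intro hd v hv
    by_contra hne
    apply hd
    refine Matrix.exists_vecMul_eq_zero_iff.1 ⟨Fin.cons 0 v, ?_, ?_⟩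
    · intro h0; apply hne; ext i
      have := congrFun h0 i.succ
      simpa using this
    · rw [hom_vecMul h]
      ext c
      refine Fin.cases ?_ (fun j => ?_) c
      · simp
      · simp [hv]
  · intro hinj hd
    obtain ⟨v, hv, hvW⟩ := Matrix.exists_vecMul_eq_zero_iff.2 hd
    rw [hom_vecMul h] at hvW
    have h0 : v 0 = 0 := congrFun hvW 0
    have h1 : (fun i : Fin (n+1) => v i.succ) = 0 := by
      apply hinj
      ext j
      have := congrFun hvW j.succ
      simpa [h0] using this
    apply hv
    ext c
    refine Fin.cases h0 (fun i => congrFun h1 i) c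

theorem hom_hyperquadric (φ : (Fin (n+1) → ℂ) → (Fin (n+1) → ℂ)) (e : ℕ) (z) :
    hf e (fun c => hom φ c z) (fun c => star (hom φ c z)) = 0 ↔ φ z ∈ hyperquadric n e := by
  rw [hf_expand, ← Fin.succ_last]
  simp only [hom_zero, hom_succ, hyperquadric, Set.mem_ofPred_eq, star_one, mul_one, one_mul]
  have h1 : ∑ α : Fin n, eps e α * φ z α.castSucc * star (φ z α.castSucc)
      = ((∑ α : Fin n, (if (α : ℕ) < e then (1 : ℝ) else -1) * Complex.normSq (φ z α.castSucc) : ℝ) : ℂ) := by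
    push_cast
    refine Finset.sum_congr rfl fun α _ => ?_
    rw [mul_assoc]
    have : φ z α.castSucc * star (φ z α.castSucc) = (Complex.normSq (φ z α.castSucc) : ℂ) := Complex.mul_conj _
    rw [this, eps]; split_ifs <;> simp
  rw [h1]
  have h2 : φ z (Fin.last n) - star (φ z (Fin.last n)) = 2 * Complex.I * ((φ z (Fin.last n)).im : ℂ) := by
    have := Complex.sub_conj (φ z (Fin.last n))
    rw [Complex.star_def, this]; push_cast; ring
  rw [h2, ← mul_sub, mul_eq_zero, sub_eq_zero, Complex.ofReal_inj]
  simp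

theorem hf_smul (e : ℕ) (a b : Fin (n+2) → ℂ) (s t : ℂ) : hf e (fun c => s * a c) (fun c => t * b c) = s * t * hf e a b := by
  simp only [hf_expand]
  have : ∑ α : Fin n, eps e α * (s * a α.castSucc.succ) * (t * b α.castSucc.succ)
     = s * t * ∑ α : Fin n, eps e α * a α.castSucc.succ * b α.castSucc.succ := by
    rw [Finset.mul_sum]; exact Finset.sum_congr rfl fun _ _ => by ring
  rw [this]; ring

theorem normalize {M : Set (Fin (n+1) → ℂ)} {q : Fin (n+1) → ℂ} (h : IsSphericalPt n M q) :
    ∃ e ≤ n, ∃ f, Good e M q f := by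
  obtain ⟨U, φ, e, he, hU, hq, hφ, -, hOpen, ⟨ψ, hψ, hψφ⟩, hM⟩ := h
  refine ⟨e, he, ?_⟩
  have hinj : Function.Injective (fderiv ℂ φ q) := by
    have h1 : HasFDerivAt (ψ ∘ φ) ((fderiv ℂ ψ (φ q)).comp (fderiv ℂ φ q)) q :=
      (hψ (φ q) ⟨q, hq, rfl⟩).differentiableAt.hasFDerivAt.comp q (hφ q hq).differentiableAt.hasFDerivAt
    have h2 : HasFDerivAt (ψ ∘ φ) (ContinuousLinearMap.id ℂ _) q := by
      refine (hasFDerivAt_id q).congr_of_eventuallyEq ?_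
      filter_upwards [hU.mem_nhds hq] with x hx using hψφ x hx
    have h3 := h1.unique h2
    intro v w hvw
    have h4 := congrArg (fun L => L v) h3
    have h5 := congrArg (fun L => L w) h3
    simp only [ContinuousLinearMap.comp_apply, ContinuousLinearMap.id_apply] at h4 h5
    rw [← h4, ← h5, hvw]
  let d : (Fin (n+1) → ℂ) → ℂ := fun z => (Wm (hom φ) z).det
  have hda : ∀ z ∈ U, AnalyticAt ℂ d z := fun z hz => an_det fun a c => an_W (fun c => an_hom (hφ z hz) c) a c
  have hdq : d q ≠ 0 := (det_hom_iff (hφ q hq)).2 hinj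
  let g : (Fin (n+1) → ℂ) → ℂ := fun z => Complex.exp (-(Complex.log (d z / d q)) / (n+2))
  have hga : AnalyticAt ℂ g q := by
    have h1 : AnalyticAt ℂ (fun z => d z / d q) q := (hda q hq).fun_div analyticAt_const hdq
    have h2 : AnalyticAt ℂ (fun z => Complex.log (d z / d q)) q := h1.clog (by
      rw [div_self hdq]; simp)
    have hne : (n+2 : ℂ) ≠ 0 := by exact_mod_cast (by omega : n+2 ≠ 0)
    exact (h2.fun_neg.fun_div analyticAt_const hne).cexp'
  refine ⟨fun c z => g z * hom φ c z, fun c => hga.fun_mul (an_hom (hφ q hq) c), ⟨d q, hdq, ?_⟩, ?_⟩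
  · filter_upwards [hga.eventually_analyticAt, hU.mem_nhds hq, (hda q hq).continuousAt.eventually_ne hdq] with z h1 h2 h3
    rw [W_scale h1 (fun c => an_hom (hφ z h2) c)]
    have hne : (n+2 : ℂ) ≠ 0 := by exact_mod_cast (by omega : n+2 ≠ 0)
    have h4 : g z ^ (n+2) = (d z / d q)⁻¹ := by
      change Complex.exp _ ^ (n+2) = _
      rw [← Complex.exp_nat_mul]
      have : ((n+2 : ℕ) : ℂ) * (-(Complex.log (d z / d q)) / (n+2)) = -(Complex.log (d z / d q)) := by
        push_cast; field_simp
      rw [this, Complex.exp_neg, Complex.exp_log (div_ne_zero h3 hdq)]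
    rw [h4]
    change (d z / d q)⁻¹ * d z = d q
    field_simp
  · filter_upwards [hU.mem_nhds hq] with z hz hzM
    simp only [star_mul']
    rw [hf_smul, (hom_hyperquadric φ e z).2 (hM ⟨z, ⟨hz, hzM⟩, rfl⟩), mul_zero]

end
end Sph
end

section
open Topology Filter Metric

namespace Sph
section
variable {n : ℕ}

theorem idx_cases (c : Fin (n+2)) : c = 0 ∨ c = Fin.last (n+1) ∨ ∃ α : Fin n, c = α.castSucc.succ := by
  refine Fin.cases (Or.inl rfl) (fun j => ?_) c
  refine Fin.lastCases (Or.inr (Or.inl (Fin.succ_last n))) (fun α => Or.inr (Or.inr ⟨α, rfl⟩)) j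

theorem ne1 (α : Fin n) : α.castSucc.succ ≠ (0 : Fin (n+2)) := Fin.succ_ne_zero _
theorem ne2 (α : Fin n) : α.castSucc.succ ≠ Fin.last (n+1) := by
  rw [← Fin.succ_last]; intro h
  exact (Fin.castSucc_lt_last α).ne (Fin.succ_injective _ h)
theorem ne3 : (0 : Fin (n+2)) ≠ Fin.last (n+1) := (Fin.last_pos).ne
theorem ne4 (α β : Fin n) : (α.castSucc.succ : Fin (n+2)) = β.castSucc.succ ↔ α = β := by
  constructor
  · intro h; exact Fin.castSucc_injective _ (Fin.succ_injective _ h)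
  · rintro rfl; rfl

/-- swap map -/
noncomputable def Sw : (Fin (n+2) → ℂ) →ₗ[ℂ] (Fin (n+2) → ℂ) where
  toFun b c := if c = 0 then b (Fin.last (n+1)) else if c = Fin.last (n+1) then - b 0 else b c
  map_add' a b := by
    ext c; simp only [Pi.add_apply]; split_ifs <;> ring
  map_smul' s b := by
    ext c; simp only [Pi.smul_apply, smul_eq_mul, RingHom.id_apply]; split_ifs <;> ring

theorem Sw_apply (b : Fin (n+2) → ℂ) (c) : Sw b c = if c = 0 then b (Fin.last (n+1)) else if c = Fin.last (n+1) then - b 0 else b c := rfl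

noncomputable def Nm (e : ℕ) (α : Fin n) : (Fin (n+2) → ℂ) →ₗ[ℂ] (Fin (n+2) → ℂ) where
  toFun b c := b c + (if c = α.castSucc.succ then b 0 else 0)
    + (if c = Fin.last (n+1) then 2 * Complex.I * eps e α * b α.castSucc.succ + Complex.I * eps e α * b 0 else 0)
  map_add' a b := by
    ext c; simp only [Pi.add_apply]; split_ifs <;> ring
  map_smul' s b := by
    ext c; simp only [Pi.smul_apply, smul_eq_mul, RingHom.id_apply]; split_ifs <;> ring

theorem Nm_apply (e : ℕ) (α : Fin n) (b : Fin (n+2) → ℂ) (c) : Nm e α b c = b c + (if c = α.castSucc.succ then b 0 else 0)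
    + (if c = Fin.last (n+1) then 2 * Complex.I * eps e α * b α.castSucc.succ + Complex.I * eps e α * b 0 else 0) := rfl

theorem Sw_inj : Function.Injective (Sw : (Fin (n+2) → ℂ) →ₗ[ℂ] (Fin (n+2) → ℂ)) := by
  rw [injective_iff_map_eq_zero]
  intro b hb
  have h0 := congrFun hb 0
  have h1 := congrFun hb (Fin.last (n+1))
  simp [Sw_apply] at h0 h1
  ext c
  rcases idx_cases c with rfl | rfl | ⟨α, rfl⟩
  · simpa using h1
  · simpa using h0
  · have := congrFun hb α.castSucc.succ
    rw [Sw_apply, if_neg (ne1 α), if_neg (ne2 α)] at this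
    exact this

theorem Nm_inj (e : ℕ) (α : Fin n) : Function.Injective (Nm e α) := by
  rw [injective_iff_map_eq_zero]
  intro b hb
  have h0 := congrFun hb 0
  rw [Nm_apply, if_neg (ne1 α).symm, if_neg ne3] at h0
  have h0 : b 0 = 0 := by simpa using h0
  have h2 : ∀ β : Fin n, b β.castSucc.succ = 0 := by
    intro β
    have := congrFun hb β.castSucc.succ
    rw [Nm_apply, if_neg (ne2 β), h0] at this
    simpa using this
  have h1 := congrFun hb (Fin.last (n+1))
  rw [Nm_apply, h0, h2] at h1
  ext c
  rcases idx_cases c with rfl | rfl | ⟨β, rfl⟩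
  · exact h0
  · simpa using h1
  · exact h2 β

theorem Sw_hf (e : ℕ) (b : Fin (n+2) → ℂ) : hf e (Sw b) (star (Sw b)) = hf e b (star b) := by
  simp only [hf_expand, Pi.star_apply]
  have h : ∀ α : Fin n, Sw b α.castSucc.succ = b α.castSucc.succ := fun α => by
    rw [Sw_apply, if_neg (ne1 α), if_neg (ne2 α)]
  have h0 : Sw b 0 = b (Fin.last (n+1)) := by rw [Sw_apply, if_pos rfl]
  have h1 : Sw b (Fin.last (n+1)) = - b 0 := by rw [Sw_apply, if_neg ne3.symm, if_pos rfl]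
  simp only [h, h0, h1, star_neg]; ring

theorem eps_star (e : ℕ) (α : Fin n) : star (eps e α) = eps e α := by unfold eps; split_ifs <;> simp

theorem Nm_hf (e : ℕ) (α : Fin n) (b : Fin (n+2) → ℂ) : hf e (Nm e α b) (star (Nm e α b)) = hf e b (star b) := by
  simp only [hf_expand, Pi.star_apply]
  have h0 : Nm e α b 0 = b 0 := by rw [Nm_apply, if_neg (ne1 α).symm, if_neg ne3]; simp
  have h1 : Nm e α b (Fin.last (n+1)) = b (Fin.last (n+1)) + (2 * Complex.I * eps e α * b α.castSucc.succ + Complex.I * eps e α * b 0) := by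
    rw [Nm_apply, if_neg (ne2 α).symm, if_pos rfl]; simp
  have h2 : ∑ β : Fin n, eps e β * Nm e α b β.castSucc.succ * star (Nm e α b β.castSucc.succ)
      = ∑ β : Fin n, eps e β * b β.castSucc.succ * star (b β.castSucc.succ)
        + eps e α * (b α.castSucc.succ * star (b 0) + b 0 * star (b α.castSucc.succ) + b 0 * star (b 0)) := by
    have : ∀ β : Fin n, eps e β * Nm e α b β.castSucc.succ * star (Nm e α b β.castSucc.succ)
      = eps e β * b β.castSucc.succ * star (b β.castSucc.succ)
       + if β = α then eps e α * (b α.castSucc.succ * star (b 0) + b 0 * star (b α.castSucc.succ) + b 0 * star (b 0)) else 0 := by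
      intro β
      rw [Nm_apply, if_neg (ne2 β)]
      simp only [ne4]
      split_ifs with h
      · subst h; simp only [star_add, add_zero]; ring
      · simp
    simp only [this, Finset.sum_add_distrib]
    simp
  rw [h0, h1, h2]
  have hI : star Complex.I = - Complex.I := Complex.conj_I
  have h22 : star (2 : ℂ) = 2 := by simp
  simp only [star_add, star_mul', hI, eps_star, h22]
  ring

theorem exists_T (e : ℕ) (a : Fin (n+2) → ℂ) (ha : a ≠ 0) : ∃ T : (Fin (n+2) → ℂ) →ₗ[ℂ] (Fin (n+2) → ℂ),
    Function.Injective T ∧ (∀ b, hf e (T b) (star (T b)) = hf e b (star b)) ∧ T a 0 ≠ 0 := by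
  by_cases h0 : a 0 = 0
  · by_cases h1 : a (Fin.last (n+1)) = 0
    · have : ∃ α : Fin n, a α.castSucc.succ ≠ 0 := by
        by_contra! hc
        apply ha; ext c
        rcases idx_cases c with rfl | rfl | ⟨β, rfl⟩
        · exact h0
        · exact h1
        · exact hc β
      obtain ⟨α, hα⟩ := this
      refine ⟨Sw ∘ₗ Nm e α, Sw_inj.comp (Nm_inj e α), fun b => ?_, ?_⟩
      · rw [LinearMap.comp_apply, Sw_hf, Nm_hf]
      · rw [LinearMap.comp_apply, Sw_apply, if_pos rfl, Nm_apply, if_neg (ne2 α).symm, if_pos rfl, h1, h0]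
        simp [eps_ne, hα]
    · refine ⟨Sw, Sw_inj, Sw_hf e, ?_⟩
      rw [Sw_apply, if_pos rfl]; exact h1
  · exact ⟨LinearMap.id, fun _ _ h => h, fun _ => rfl, h0⟩

theorem T_apply (T : (Fin (n+2) → ℂ) →ₗ[ℂ] (Fin (n+2) → ℂ)) (v) (c) : T v c = ∑ d, LinearMap.toMatrix' T c d * v d := by
  conv_lhs => rw [← LinearMap.toMatrix'_mulVec T v]
  rfl

theorem Wm_congr {f g : Fin (n+2) → (Fin (n+1) → ℂ) → ℂ} {p} (h : ∀ c, f c =ᶠ[𝓝 p] g c) : Wm f p = Wm g p := by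
  ext a c
  refine Fin.cases ?_ (fun i => ?_) a
  · simp only [Wm_zero]; exact (h c).eq_of_nhds
  · simp only [Wm_succ]; exact dd_congr (h c) _

theorem W_T {f : Fin (n+2) → (Fin (n+1) → ℂ) → ℂ} {p} (hf : ∀ c, AnalyticAt ℂ (f c) p) (T : (Fin (n+2) → ℂ) →ₗ[ℂ] (Fin (n+2) → ℂ)) :
    Wm (fun c y => T (fun d => f d y) c) p = Wm f p * (LinearMap.toMatrix' T).transpose := by
  ext a c
  rw [Matrix.mul_apply]
  simp only [T_apply, Matrix.transpose_apply]
  refine Fin.cases ?_ (fun i => ?_) a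
  · simp only [Wm_zero]
    exact Finset.sum_congr rfl fun _ _ => mul_comm _ _
  · simp only [Wm_succ]
    rw [dd_sum _ (fun d _ => analyticAt_const.fun_mul (hf d))]
    refine Finset.sum_congr rfl fun d _ => ?_
    rw [dd_mul analyticAt_const (hf d), dd_const]; ring

theorem local_inv {φ : (Fin (n+1) → ℂ) → (Fin (n+1) → ℂ)} {p} (hφ : AnalyticAt ℂ φ p)
    (hinj : Function.Injective (fderiv ℂ φ p)) (P : (Fin (n+1) → ℂ) → Prop) (hP : ∀ᶠ z in 𝓝 p, P z) :
    ∃ U : Set (Fin (n+1) → ℂ), IsOpen U ∧ p ∈ U ∧ AnalyticOnNhd ℂ φ U ∧ Set.InjOn φ U ∧ IsOpen (φ '' U) ∧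
      (∃ ψ, AnalyticOnNhd ℂ ψ (φ '' U) ∧ ∀ x ∈ U, ψ (φ x) = x) ∧ ∀ z ∈ U, P z := by
  let L : (Fin (n+1) → ℂ) ≃L[ℂ] (Fin (n+1) → ℂ) :=
    (LinearEquiv.ofInjectiveEndo (fderiv ℂ φ p : (Fin (n+1) → ℂ) →ₗ[ℂ] (Fin (n+1) → ℂ)) hinj).toContinuousLinearEquiv
  have hL : (L : (Fin (n+1) → ℂ) →L[ℂ] (Fin (n+1) → ℂ)) = fderiv ℂ φ p := by ext v; rfl
  have hd : HasFDerivAt φ (L : (Fin (n+1) → ℂ) →L[ℂ] (Fin (n+1) → ℂ)) p := by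
    rw [hL]; exact hφ.differentiableAt.hasFDerivAt
  have hc : ContDiffAt ℂ ⊤ φ p := hφ.contDiffAt
  have hne : (⊤ : WithTop ℕ∞) ≠ 0 := by simp
  let h := hc.toOpenPartialHomeomorph φ hd hne
  have hcoe : (h : (Fin (n+1) → ℂ) → (Fin (n+1) → ℂ)) = φ := ContDiffAt.toOpenPartialHomeomorph_coe hc hd hne
  have hs : p ∈ h.source := ContDiffAt.mem_toOpenPartialHomeomorph_source hc hd hne
  have hψ : AnalyticAt ℂ h.symm (φ p) := (ContDiffAt.to_localInverse hc hd hne).analyticAt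
  have hev : ∀ᶠ z in 𝓝 p, z ∈ h.source ∧ AnalyticAt ℂ φ z ∧ AnalyticAt ℂ h.symm (φ z) ∧ P z :=
    (show ∀ᶠ z in 𝓝 p, z ∈ h.source from h.open_source.mem_nhds hs).and (hφ.eventually_analyticAt.and
      ((hφ.continuousAt.eventually hψ.eventually_analyticAt).and hP))
  obtain ⟨U, hU, hUo, hpU⟩ := _root_.eventually_nhds_iff.1 hev
  have hinv : ∀ x ∈ U, h.symm (φ x) = x := fun x hx => by
    have := h.left_inv (hU x hx).1
    rwa [hcoe] at this
  refine ⟨U, hUo, hpU, fun z hz => (hU z hz).2.1, ?_, ?_, ⟨h.symm, ?_, hinv⟩, fun z hz => (hU z hz).2.2.2⟩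
  · intro x hx y hy hxy
    rw [← hinv x hx, ← hinv y hy, hxy]
  · have := h.isOpen_image_of_subset_source hUo (fun z hz => (hU z hz).1)
    rwa [hcoe] at this
  · rintro _ ⟨z, hz, rfl⟩
    exact (hU z hz).2.2.1

theorem good_spherical {e : ℕ} (he : e ≤ n) {M : Set (Fin (n+1) → ℂ)} {p} {f : Fin (n+2) → (Fin (n+1) → ℂ) → ℂ} (h : Good e M p f) :
    IsSphericalPt n M p := by
  obtain ⟨hfa, ⟨κ, hκ, hdet⟩, hM⟩ := h
  have hdp : (Wm f p).det ≠ 0 := by rw [hdet.self_of_nhds]; exact hκ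
  have ha : (fun c => f c p) ≠ 0 := by
    intro h0
    apply hdp
    refine Matrix.det_eq_zero_of_row_eq_zero 0 fun c => ?_
    rw [Wm_zero]; exact congrFun h0 c
  obtain ⟨T, hTi, hTh, hT0⟩ := exists_T e _ ha
  let F : Fin (n+2) → (Fin (n+1) → ℂ) → ℂ := fun c y => T (fun d => f d y) c
  have hFa : ∀ c, AnalyticAt ℂ (F c) p := by
    intro c
    have : F c = fun y => ∑ d, LinearMap.toMatrix' T c d * f d y := by
      ext y; exact T_apply T _ c
    rw [this]
    exact an_sum _ fun d _ => analyticAt_const.fun_mul (hfa d)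
  have hF0 : F 0 p ≠ 0 := hT0
  have hdF : (Wm F p).det ≠ 0 := by
    have : Wm F p = _ := W_T hfa T
    rw [this, Matrix.det_mul, Matrix.det_transpose]
    refine mul_ne_zero hdp ?_
    rw [LinearMap.det_toMatrix']
    exact (LinearEquiv.isUnit_det' (LinearEquiv.ofInjectiveEndo T hTi)).ne_zero
  let φ : (Fin (n+1) → ℂ) → (Fin (n+1) → ℂ) := fun z j => F j.succ z / F 0 z
  have hφ : AnalyticAt ℂ φ p := analyticAt_pi_iff.2 fun j => (hFa j.succ).fun_div (hFa 0) hF0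
  have hev0 : ∀ᶠ z in 𝓝 p, F 0 z ≠ 0 := (hFa 0).continuousAt.eventually_ne hF0
  have hFh : ∀ z, F 0 z ≠ 0 → ∀ c, F c z = F 0 z * hom φ c z := by
    intro z hz c
    refine Fin.cases ?_ (fun j => ?_) c
    · simp
    · simp only [hom_succ, φ]; field_simp
  have hdh : (Wm (hom φ) p).det ≠ 0 := by
    have h1 : Wm F p = Wm (fun c y => F 0 y * hom φ c y) p := by
      apply Wm_congr
      intro c
      filter_upwards [hev0] with z hz using hFh z hz c
    rw [h1, W_scale (hFa 0) (an_hom hφ)] at hdF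
    exact right_ne_zero_of_mul hdF
  have hP : ∀ᶠ z in 𝓝 p, z ∈ M → φ z ∈ hyperquadric n e := by
    filter_upwards [hev0, hM] with z hz hzM hm
    have h1 := hzM hm
    have h2 : hf e (fun c => F c z) (star (fun c => F c z)) = 0 := (hTh (fun d => f d z)).trans h1
    have h3 : (fun c => F c z) = fun c => F 0 z * hom φ c z := funext (hFh z hz)
    rw [h3] at h2
    have h4 : star (fun c => F 0 z * hom φ c z) = fun c => star (F 0 z) * star (hom φ c z) := by
      ext c; simp
    rw [h4, hf_smul] at h2
    rw [← hom_hyperquadric]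
    refine (mul_eq_zero.1 h2).resolve_left (mul_ne_zero hz (star_ne_zero.2 hz))
  obtain ⟨U, hU, hpU, h1, h2, h3, h4, h5⟩ := local_inv hφ ((det_hom_iff hφ).1 hdh) _ hP
  refine ⟨U, φ, e, he, hU, hpU, h1, h2, h3, h4, ?_⟩
  rintro _ ⟨z, ⟨hz, hzM⟩, rfl⟩
  exact h5 z hz hzM

theorem final (hn : 1 ≤ n) (M : Set (Fin (n+1) → ℂ)) (hM : IsNondegHypersurface (n+1) M) (hconn : IsConnected M)
    (p : Fin (n+1) → ℂ) (hp : p ∈ M) (hnsph : ¬ IsSphericalPt n M p) : ∀ q ∈ M, ¬ IsSphericalPt n M q := by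
  intro q hq hsph
  let u : Set (Fin (n+1) → ℂ) := {x | ∃ U : Set (Fin (n+1) → ℂ), IsOpen U ∧ x ∈ U ∧ ∀ y ∈ U, y ∈ M → IsSphericalPt n M y}
  let v : Set (Fin (n+1) → ℂ) := {x | ∃ U : Set (Fin (n+1) → ℂ), IsOpen U ∧ x ∈ U ∧ ∀ y ∈ U, y ∈ M → ¬ IsSphericalPt n M y}
  have hu : IsOpen u := by
    rw [isOpen_iff_mem_nhds]
    rintro x ⟨U, hU, hx, h⟩
    filter_upwards [hU.mem_nhds hx] with y hy using ⟨U, hU, hy, h⟩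
  have hv : IsOpen v := by
    rw [isOpen_iff_mem_nhds]
    rintro x ⟨U, hU, hx, h⟩
    filter_upwards [hU.mem_nhds hx] with y hy using ⟨U, hU, hy, h⟩
  have hus : ∀ x ∈ M, IsSphericalPt n M x → x ∈ u := by
    rintro x hx ⟨U, φ, e, he, hU, hxU, h⟩
    exact ⟨U, hU, hxU, fun y hy _ => ⟨U, φ, e, he, hU, hy, h⟩⟩
  have hvs : ∀ x ∈ M, ¬ IsSphericalPt n M x → x ∈ v := by
    intro x hx hns
    obtain ⟨O, hO, hxO, h⟩ := propagate hn M hM x hx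
    refine ⟨O, hO, hxO, fun y hy hyM hs => hns ?_⟩
    obtain ⟨e, he, f, hf⟩ := normalize hs
    obtain ⟨f', hf'⟩ := h y hy hyM e f hf
    exact good_spherical he hf'
  obtain ⟨x, hxM, ⟨U, -, hxU, h1⟩, ⟨V, -, hxV, h2⟩⟩ := hconn.isPreconnected u v hu hv (fun x hx => by
    by_cases hs : IsSphericalPt n M x
    · exact Or.inl (hus x hx hs)
    · exact Or.inr (hvs x hx hs)) ⟨q, hq, hus q hq hsph⟩ ⟨p, hp, hvs p hp hnsph⟩
  exact h2 x hxV hxM (h1 x hxU hxM)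

end
end Sph
end

/-- Let `M ⊆ ℂ^{n+1}` be a connected nondegenerate real-analytic
real hypersurface. If some point `p ∈ M` is not spherical, then no point of `M` is
spherical. -/
theorem stmt15 (n : ℕ) (hn : 1 ≤ n) (M : Set (Fin (n + 1) → ℂ))
    (hM : IsNondegHypersurface (n + 1) M)
    (hconn : IsConnected M)
    (p : Fin (n + 1) → ℂ) (hp : p ∈ M)
    (hnsph : ¬ IsSphericalPt n M p) :
    ∀ q ∈ M, ¬ IsSphericalPt n M q := by
  exact Sph.final hn M hM hconn p hp hnsph
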